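/- arXiv:1805.10075 — 14 statements merged into one kernel-verified Lean document; each statement's English description precedes it below -/
import Mathlib

section
/- For every a > 0 and α > 0, the equation α = −√λ · cot(a√λ/2) has exactly one solution λ in the open interval (π²/a², 4π²/a²). (This solution is the second eigenvalue of the Robin Laplacian on an interval of length a with boundary parameter α.) -/
open Real

lemma strictMonoOn_neg_mul_cos_sub_mul_sin {c : ℝ} (hc : 0 < c) :
    StrictMonoOn (fun x : ℝ => -(x * cos x) - c * sin x) (Set.Icc (π / 2) π) := by
  intro x hx y hy hxy
  have hπ := pi_pos
  have hcos : cos y < cos x :=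
    strictAntiOn_cos ⟨by linarith [hx.1], hx.2⟩ ⟨by linarith [hy.1], hy.2⟩ hxy
  have hcosx : cos x ≤ 0 := cos_nonpos_of_pi_div_two_le_of_le hx.1 (by linarith [hx.2])
  have hsin : sin y < sin x := by
    rw [← sin_pi_sub y, ← sin_pi_sub x]
    exact strictMonoOn_sin ⟨by linarith [hy.2], by linarith [hy.1]⟩
      ⟨by linarith [hx.2], by linarith [hx.1]⟩ (by linarith)
  have hx0 : 0 < x := by linarith [hx.1]
  dsimp only
  nlinarith [mul_pos hc (sub_pos.2 hsin), mul_pos (hx0.trans hxy) (sub_pos.2 hcos),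
    mul_nonneg (sub_pos.2 hxy).le (neg_nonneg.2 hcosx)]

lemma eq_neg_mul_cot_iff {c x : ℝ} (hx : 0 < sin x) :
    c = -(x * cot x) ↔ -(x * cos x) - c * sin x = 0 := by
  rw [cot_eq_cos_div_sin, ← mul_div_assoc, ← neg_div, eq_div_iff hx.ne', sub_eq_zero, eq_comm]

lemma existsUnique_eq_neg_mul_cot {c : ℝ} (hc : 0 < c) :
    ∃! x : ℝ, x ∈ Set.Ioo (π / 2) π ∧ c = -(x * cot x) := by
  have hπ := pi_pos
  have hsin : ∀ x ∈ Set.Ioo (π / 2) π, 0 < sin x := fun x hx =>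
    sin_pos_of_pos_of_lt_pi (by linarith [hx.1]) hx.2
  have hcont : ContinuousOn (fun x : ℝ => -(x * cos x) - c * sin x) (Set.Icc (π / 2) π) := by
    fun_prop
  obtain ⟨x, hx, hx0⟩ := intermediate_value_Ioo (by linarith : π / 2 ≤ π) hcont
    (show (0 : ℝ) ∈ _ by simpa using ⟨hc, hπ⟩)
  refine ⟨x, ⟨hx, (eq_neg_mul_cot_iff (hsin x hx)).2 hx0⟩, ?_⟩
  rintro y ⟨hy, hy0⟩
  exact (strictMonoOn_neg_mul_cos_sub_mul_sin hc).injOn (Set.Ioo_subset_Icc_self hy)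
    (Set.Ioo_subset_Icc_self hx) (((eq_neg_mul_cot_iff (hsin y hy)).1 hy0).trans hx0.symm)

/-- For every `a > 0` and `α > 0`, the equation `α = −√λ · cot(a√λ/2)` has exactly one
solution `λ` in the open interval `(π²/a², 4π²/a²)`. -/
theorem unique_second_robin_eigenvalue (a α : ℝ) (ha : 0 < a) (hα : 0 < α) :
    ∃! lam : ℝ, lam ∈ Set.Ioo (π ^ 2 / a ^ 2) (4 * π ^ 2 / a ^ 2) ∧
      α = -(Real.sqrt lam * Real.cot (a * Real.sqrt lam / 2)) := by
  have hπ := pi_pos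
  obtain ⟨x, ⟨hx, hxe⟩, hxu⟩ :=
    existsUnique_eq_neg_mul_cot (c := a * α / 2) (by positivity)
  have hx0 : 0 < x := by linarith [hx.1]
  have hsqrt : √((2 * x / a) ^ 2) = 2 * x / a := sqrt_sq (by positivity)
  have harg : a * (2 * x / a) / 2 = x := by field_simp
  refine ⟨(2 * x / a) ^ 2, ⟨⟨?_, ?_⟩, ?_⟩, ?_⟩
  · rw [div_pow]
    gcongr
    linarith [hx.1]
  · rw [div_pow, show 4 * π ^ 2 = (2 * π) ^ 2 by ring]
    gcongr
    exact hx.2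
  · rw [hsqrt, harg]
    field_simp
    linarith
  · rintro lam ⟨⟨hl, hu⟩, he⟩
    have hlam : 0 ≤ lam := le_trans (by positivity) hl.le
    have hl' : π / a < √lam := lt_sqrt_of_sq_lt (by rwa [div_pow])
    have hu' : √lam < 2 * π / a := by
      rwa [sqrt_lt' (by positivity), div_pow, show (2 * π) ^ 2 = 4 * π ^ 2 by ring]
    rw [div_lt_iff₀ ha] at hl'
    rw [lt_div_iff₀ ha] at hu'
    have h := hxu (a * √lam / 2) ⟨⟨by linarith, by linarith⟩, by
      linear_combination a / 2 * he⟩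
    rw [← h, show 2 * (a * √lam / 2) / a = √lam by field_simp, sq_sqrt hlam]
end

section
/- For every a > 0 and α > 0, the first Robin eigenvalue satisfies λ₁(a,α) ≤ (2·√(6aα + 9) − 6)/a². -/
open Real

/-- The third-order Taylor lower bound for the tangent on `[0, π/2)`. -/
theorem add_cube_div_three_le_tan {x : ℝ} (hx : 0 ≤ x) (hx' : x < π / 2) :
    x + x ^ 3 / 3 ≤ tan x := by
  have hcos : ∀ y ∈ Set.Ico 0 (π / 2), 0 < cos y := fun y hy =>
    cos_pos_of_mem_Ioo ⟨by linarith [hy.1, pi_pos], hy.2⟩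
  have hderiv : ∀ y ∈ Set.Ico 0 (π / 2),
      HasDerivAt (fun z => tan z - (z + z ^ 3 / 3)) (tan y ^ 2 - y ^ 2) y := by
    intro y hy
    have hc := (hcos y hy).ne'
    have h := (hasDerivAt_tan hc).sub
      ((hasDerivAt_id y).add (((hasDerivAt_id y).pow 3).div_const 3))
    refine h.congr_deriv ?_
    rw [one_div, ← inv_one_add_tan_sq hc, inv_inv]
    simp only [id_eq]
    push_cast
    ring
  have hmono : MonotoneOn (fun z => tan z - (z + z ^ 3 / 3)) (Set.Ico 0 (π / 2)) := by
    refine monotoneOn_of_deriv_nonneg (convex_Ico _ _)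
      (fun y hy => (hderiv y hy).continuousAt.continuousWithinAt)
      (fun y hy => (hderiv y (interior_subset hy)).differentiableAt.differentiableWithinAt) ?_
    intro y hy
    have hy' := interior_subset hy
    rw [(hderiv y hy').deriv]
    exact sub_nonneg.2 (pow_le_pow_left₀ hy'.1 (le_tan hy'.1 hy'.2) 2)
  have h := hmono ⟨le_rfl, by positivity⟩ ⟨hx, hx'⟩ hx
  simp only [tan_zero] at h
  linarith

/-- For every `a > 0` and `α > 0`, the first Robin eigenvalue `λ₁(a,α)`, i.e. the unique
`λ ∈ (0, π²/a²)` satisfying `α = √λ · tan(a√λ/2)`, satisfies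
`λ₁(a,α) ≤ (2·√(6aα + 9) − 6)/a²`. -/
theorem first_robin_eigenvalue_le' (a α lam : ℝ) (ha : 0 < a) (hα : 0 < α)
    (hmem : lam ∈ Set.Ioo 0 (π ^ 2 / a ^ 2))
    (heq : α = Real.sqrt lam * Real.tan (a * Real.sqrt lam / 2)) :
    lam ≤ (2 * Real.sqrt (6 * a * α + 9) - 6) / a ^ 2 := by
  obtain ⟨hpos, hlt⟩ := hmem
  have hsq : √lam ^ 2 = lam := sq_sqrt hpos.le
  have hlt' : a * √lam / 2 < π / 2 := by
    have h : (a * √lam) ^ 2 < π ^ 2 := by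
      rw [mul_pow, hsq, mul_comm]
      exact (lt_div_iff₀ (by positivity)).1 hlt
    linarith [lt_of_pow_lt_pow_left₀ 2 pi_pos.le h]
  have hx : 0 ≤ a * √lam / 2 := by positivity
  have htan := mul_le_mul_of_nonneg_left (add_cube_div_three_le_tan hx hlt') hx
  have hsqrt : 2 * (a * √lam / 2) ^ 2 + 3 ≤ √(6 * a * α + 9) := by
    apply le_sqrt_of_sq_le
    have h : 6 * a * α = 12 * (a * √lam / 2 * tan (a * √lam / 2)) := by
      rw [heq]
      ring
    rw [h]
    linarith
  rw [le_div_iff₀ (by positivity)]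
  have h : lam * a ^ 2 = 4 * (a * √lam / 2) ^ 2 := by
    rw [div_pow, mul_pow, hsq]
    ring
  linarith
end

section
/- For every a > 0 and α > 0, the first Robin eigenvalue satisfies the two-sided bound 2απ²/(a(π² + 2αa)) ≤ λ₁(a,α) ≤ απ²/(a(4 + αa)). -/
open Real

/-- A differentiable function with a dip at `m` decreases somewhere before `m` and increases
somewhere after `m`. -/
theorem exists_deriv_neg_and_pos_of_dip {f f' : ℝ → ℝ} (hf : ∀ x, HasDerivAt f (f' x) x)
    {u m v : ℝ} (hum : u < m) (hmv : m < v) (hu : f m < f u) (hv : f m < f v) :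
    (∃ c ∈ Set.Ioo u m, f' c < 0) ∧ ∃ d ∈ Set.Ioo m v, 0 < f' d := by
  have hcont : Continuous f := continuous_iff_continuousAt.2 fun x => (hf x).continuousAt
  obtain ⟨c, hc, hc'⟩ := exists_hasDerivAt_eq_slope f f' hum hcont.continuousOn fun x _ => hf x
  obtain ⟨d, hd, hd'⟩ := exists_hasDerivAt_eq_slope f f' hmv hcont.continuousOn fun x _ => hf x
  refine ⟨⟨c, hc, ?_⟩, d, hd, ?_⟩
  · rw [hc']
    exact div_neg_of_neg_of_pos (by linarith) (by linarith)
  · rw [hd']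
    exact div_pos (by linarith) (by linarith)

/-- The lower Becker–Stark inequality, with denominators cleared. -/
theorem eight_mul_mul_cos_le {x : ℝ} (h0 : 0 < x) (h1 : x < π / 2) :
    8 * x * cos x ≤ sin x * (π ^ 2 - 4 * x ^ 2) := by
  by_contra! h
  have hd : ∀ y, HasDerivAt (fun y => sin y * (π ^ 2 - 4 * y ^ 2) - 8 * y * cos y)
      (cos y * (π ^ 2 - 8 - 4 * y ^ 2)) y := by
    intro y
    have := ((hasDerivAt_sin y).mul (((hasDerivAt_pow 2 y).const_mul 4).const_sub (π ^ 2))).sub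
      (((hasDerivAt_id y).const_mul 8).mul (hasDerivAt_cos y))
    refine this.congr_deriv ?_
    simp
    ring
  obtain ⟨⟨c, ⟨hc0, hc1⟩, hc⟩, d, ⟨hd0, hd1⟩, hd⟩ := exists_deriv_neg_and_pos_of_dip hd h0 h1
    (by simp; linarith) (by simp; ring_nf at h ⊢; linarith)
  have hcosc : 0 < cos c := cos_pos_of_mem_Ioo ⟨by linarith, by linarith⟩
  have hcosd : 0 < cos d := cos_pos_of_mem_Ioo ⟨by linarith, by linarith⟩
  have h2 : π ^ 2 - 8 - 4 * c ^ 2 < 0 := neg_of_mul_neg_right hc hcosc.le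
  have h3 : 0 < π ^ 2 - 8 - 4 * d ^ 2 := pos_of_mul_pos_right hd hcosd.le
  nlinarith

/-- The upper Becker–Stark inequality, with denominators cleared. -/
theorem sin_mul_le_pi_sq_mul_mul_cos {x : ℝ} (h0 : 0 < x) (h1 : x < π / 2) :
    sin x * (π ^ 2 - 4 * x ^ 2) ≤ π ^ 2 * x * cos x := by
  by_contra! h
  have hg : ∀ y, HasDerivAt (fun y => π ^ 2 * y * cos y - sin y * (π ^ 2 - 4 * y ^ 2))
      (y * (4 * y * cos y - (π ^ 2 - 8) * sin y)) y := by
    intro y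
    have := (((hasDerivAt_id y).const_mul (π ^ 2)).mul (hasDerivAt_cos y)).sub
      ((hasDerivAt_sin y).mul (((hasDerivAt_pow 2 y).const_mul 4).const_sub (π ^ 2)))
    refine this.congr_deriv ?_
    simp
    ring
  have hk : ∀ y, HasDerivAt (fun y => 4 * y * cos y - (π ^ 2 - 8) * sin y)
      ((12 - π ^ 2) * cos y - 4 * y * sin y) y := by
    intro y
    have := (((hasDerivAt_id y).const_mul 4).mul (hasDerivAt_cos y)).sub
      ((hasDerivAt_sin y).const_mul (π ^ 2 - 8))
    refine this.congr_deriv ?_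
    simp
    ring
  obtain ⟨⟨c, ⟨hc0, hc1⟩, hc⟩, d, ⟨hd0, hd1⟩, hd⟩ := exists_deriv_neg_and_pos_of_dip hg h0 h1
    (by simp; linarith) (by simp; ring_nf at h ⊢; linarith)
  have hkc : 4 * c * cos c - (π ^ 2 - 8) * sin c < 0 := neg_of_mul_neg_right hc hc0.le
  have hkd : 0 < 4 * d * cos d - (π ^ 2 - 8) * sin d :=
    pos_of_mul_pos_right hd (by linarith)
  obtain ⟨⟨p, ⟨hp0, hp1⟩, hp⟩, q, ⟨hq0, hq1⟩, hq⟩ := exists_deriv_neg_and_pos_of_dip hk hc0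
    (hc1.trans hd0) (by simp; linarith) (by linarith)
  have hpi : π ^ 2 < 12 := by nlinarith [pi_lt_d2, pi_pos]
  have hcos : cos q ≤ cos p := cos_le_cos_of_nonneg_of_le_pi hp0.le (by linarith) (by linarith)
  have hsin : sin p ≤ sin q := sin_le_sin_of_le_of_le_pi_div_two (by linarith) (by linarith)
    (by linarith)
  have hsinp : 0 < sin p := sin_pos_of_pos_of_lt_pi hp0 (by linarith)
  have hmul : p * sin p ≤ q * sin q := mul_le_mul (by linarith) hsin hsinp.le (by linarith)
  nlinarith [mul_le_mul_of_nonneg_left hcos (sub_nonneg.2 hpi.le)]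

/-- For every `a > 0` and `α > 0`, the first Robin eigenvalue `λ₁(a,α)`, i.e. the unique
`λ ∈ (0, π²/a²)` satisfying `α = √λ · tan(a√λ/2)`, satisfies the two-sided bound
`2απ²/(a(π² + 2αa)) ≤ λ₁(a,α) ≤ απ²/(a(4 + αa))`. -/
theorem first_robin_eigenvalue_two_sided (a α lam : ℝ) (ha : 0 < a) (hα : 0 < α)
    (hmem : lam ∈ Set.Ioo 0 (π ^ 2 / a ^ 2))
    (heq : α = Real.sqrt lam * Real.tan (a * Real.sqrt lam / 2)) :
    2 * α * π ^ 2 / (a * (π ^ 2 + 2 * α * a)) ≤ lam ∧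
      lam ≤ α * π ^ 2 / (a * (4 + α * a)) := by
  obtain ⟨hl0, hl1⟩ := hmem
  have hs0 : 0 < √lam := sqrt_pos.2 hl0
  have hlam : lam = √lam ^ 2 := (sq_sqrt hl0.le).symm
  set s := √lam
  have hsa : a * s < π := by
    rw [lt_div_iff₀ (by positivity), hlam] at hl1
    exact lt_of_pow_lt_pow_left₀ 2 pi_pos.le (by linarith [mul_pow a s 2])
  obtain ⟨x, hx⟩ : ∃ x, x = a * s / 2 := ⟨_, rfl⟩
  rw [← hx] at heq
  have hx0 : 0 < x := by rw [hx]; positivity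
  have hx1 : x < π / 2 := by linarith
  have hcos : 0 < cos x := cos_pos_of_mem_Ioo ⟨by linarith, hx1⟩
  have htan : sin x = tan x * cos x := (tan_mul_cos hcos.ne').symm
  have hlow : 8 * x ≤ tan x * (π ^ 2 - 4 * x ^ 2) := by
    have := eight_mul_mul_cos_le hx0 hx1
    rw [htan] at this
    exact le_of_mul_le_mul_right (by linarith) hcos
  have hupp : tan x * (π ^ 2 - 4 * x ^ 2) ≤ π ^ 2 * x := by
    have := sin_mul_le_pi_sq_mul_mul_cos hx0 hx1
    rw [htan] at this
    exact le_of_mul_le_mul_right (by linarith) hcos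
  rw [div_le_iff₀ (by positivity), le_div_iff₀ (by positivity), hlam, heq]
  rw [hx] at hlow hupp ⊢
  constructor
  · linear_combination 2 * s * hupp
  · linear_combination s * hlow
end

section
/- For every a > 0 and α > 0, the first Robin eigenvalue satisfies 2απ²/(a(π² + 2αa)) ≤ λ₁(a,α) ≤ (π²/a²) · (π² + 2aα − √(64aα + (π² − 2aα)²)) / (2(π² − 8)). -/
open Real

/-- The Mittag-Leffler expansion of the cotangent at a real point of `(0, 1)`. -/
lemma hasSum_cot_pi_mul {z : ℝ} (h0 : 0 < z) (h1 : z < 1) :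
    HasSum (fun n : ℕ => 2 * z / ((n : ℝ) ^ 2 - z ^ 2)) (-1 / z - π * cot (π * z)) := by
  have hz : (z : ℂ) ∈ Complex.integerComplement := by
    rintro ⟨n, hn⟩
    have hn' : (n : ℝ) = z := by exact_mod_cast hn
    rw [← hn'] at h0 h1
    have h0' : 0 < n := by exact_mod_cast h0
    have h1' : n < 1 := by exact_mod_cast h1
    omega
  have hs := (summable_cotTerm hz).hasSum
  have hval : ∑' n : ℕ, cotTerm (z : ℂ) n = π * Complex.cot (π * z) - 1 / z :=
    (cot_series_rep' hz).symm
  rw [hval] at hs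
  rw [← hasSum_nat_add_iff' 1, ← Complex.hasSum_ofReal]
  convert! hs.neg using 1
  · funext n
    have hm : ((n : ℝ) + 1) - z ≠ 0 := by
      have : (0 : ℝ) ≤ n := n.cast_nonneg
      linarith
    have hp : ((n : ℝ) + 1) + z ≠ 0 := by positivity
    have key : 2 * z / (((n + 1 : ℕ) : ℝ) ^ 2 - z ^ 2)
        = -(1 / (z - (n + 1)) + 1 / (z + (n + 1))) := by
      have e : (((n + 1 : ℕ) : ℝ) ^ 2 - z ^ 2) = (n + 1 - z) * (n + 1 + z) := by
        push_cast; ring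
      have e2 : z - (n + 1) = -(n + 1 - z) := by ring
      have e3 : z + (n + 1) = n + 1 + z := by ring
      rw [e, e2, e3]
      field_simp
      ring
    rw [key, cotTerm]
    push_cast
    ring
  · rw [Finset.sum_range_one]
    have : -1 / z - π * cot (π * z) - 2 * z / (((0 : ℕ) : ℝ) ^ 2 - z ^ 2)
        = -(π * cot (π * z) - 1 / z) := by
      field_simp
      simp
      field_simp
      ring
    rw [this]
    push_cast
    rfl

/-- The partial fraction expansion of the tangent on `(0, π / 2)`. -/
lemma hasSum_tan {x : ℝ} (h0 : 0 < x) (h1 : x < π / 2) :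
    HasSum (fun k : ℕ => 8 * x / ((2 * k + 1) ^ 2 * π ^ 2 - 4 * x ^ 2)) (tan x) := by
  have hπ := pi_pos
  have hz0 : 0 < x / π := by positivity
  have hw1 : 2 * (x / π) < 1 := by
    rw [← mul_div_assoc, div_lt_one hπ]; linarith
  have hz := hasSum_cot_pi_mul hz0 (by linarith)
  have hw := hasSum_cot_pi_mul (z := 2 * (x / π)) (by positivity) hw1
  have hodd := (hw.summable.comp_injective
    (i := fun k : ℕ => 2 * k + 1) (fun a b h => by simpa using h)).hasSum
  have heven : HasSum (fun k : ℕ => 2 * (2 * (x / π)) /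
      (((2 * k : ℕ) : ℝ) ^ 2 - (2 * (x / π)) ^ 2))
      (1 / 2 * (-1 / (x / π) - π * cot (π * (x / π)))) := by
    convert! hz.mul_left (1 / 2) using 1
    funext k
    have : (((2 * k : ℕ) : ℝ) ^ 2 - (2 * (x / π)) ^ 2) = 4 * ((k : ℝ) ^ 2 - (x / π) ^ 2) := by
      push_cast; ring
    rw [this]
    generalize (k : ℝ) ^ 2 - (x / π) ^ 2 = A
    ring
  have huniq := hw.unique (heven.even_add_odd hodd)
  have hs : 0 < sin x := sin_pos_of_pos_of_lt_pi h0 (by linarith)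
  have hc : 0 < cos x := cos_pos_of_mem_Ioo ⟨by linarith, h1⟩
  have hcot : cot x - 2 * cot (2 * x) = tan x := by
    rw [cot_eq_cos_div_sin, cot_eq_cos_div_sin, tan_eq_sin_div_cos, sin_two_mul, cos_two_mul']
    field_simp
    ring
  have e1 : π * (x / π) = x := by field_simp
  have e2 : π * (2 * (x / π)) = 2 * x := by field_simp
  rw [e1, e2] at huniq
  have hval := hodd.mul_left (2 / π)
  convert! hval using 1
  · funext k
    simp only [Function.comp]
    push_cast
    have : (2 * (k : ℝ) + 1) ^ 2 - (2 * (x / π)) ^ 2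
        = ((2 * k + 1) ^ 2 * π ^ 2 - 4 * x ^ 2) / π ^ 2 := by
      field_simp
      ring
    rw [this, div_div_eq_mul_div]
    field_simp
    ring
  · rw [← hcot]
    have := eq_sub_of_add_eq' huniq.symm
    rw [this]
    field_simp
    ring

lemma hasSum_one_div_odd_sq :
    HasSum (fun k : ℕ => 1 / (2 * (k : ℝ) + 1) ^ 2) (π ^ 2 / 8) := by
  obtain ⟨f, hf⟩ : ∃ f : ℕ → ℝ, f = fun n : ℕ => 1 / (n : ℝ) ^ 2 :=
    ⟨fun n => 1 / (n : ℝ) ^ 2, rfl⟩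
  have hz : HasSum f (π ^ 2 / 6) := hf ▸ hasSum_zeta_two
  have hodd := (hz.summable.comp_injective
    (i := fun k : ℕ => 2 * k + 1) (fun a b h => by simpa using h)).hasSum
  have heven : HasSum (fun k : ℕ => f (2 * k)) (1 / 4 * (π ^ 2 / 6)) := by
    convert! hz.mul_left (1 / 4) using 1
    funext k
    simp only [hf]
    push_cast
    rw [mul_pow, ← one_div_mul_one_div]
    norm_num
  have huniq := hz.unique (heven.even_add_odd hodd)
  convert! hodd using 1
  · funext k
    simp [hf]
  · linarith

lemma four_mul_sq_lt_odd_sq {x : ℝ} (h0 : 0 < x) (h1 : x < π / 2) (k : ℕ) :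
    0 < (2 * (k : ℝ) + 1) ^ 2 * π ^ 2 - 4 * x ^ 2 := by
  have hx : 0 < π ^ 2 - 4 * x ^ 2 := by nlinarith
  have : (1 : ℝ) ≤ (2 * (k : ℝ) + 1) ^ 2 := one_le_pow₀ (by linarith [k.cast_nonneg (α := ℝ)])
  nlinarith [sq_nonneg π]

/-- The Becker-Stark upper bound for the tangent. -/
lemma tan_le_becker_stark {x : ℝ} (h0 : 0 < x) (h1 : x < π / 2) :
    tan x ≤ π ^ 2 * x / (π ^ 2 - 4 * x ^ 2) := by
  have hx : 0 < π ^ 2 - 4 * x ^ 2 := by nlinarith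
  have h := hasSum_one_div_odd_sq.mul_left (8 * x / (π ^ 2 - 4 * x ^ 2))
  have hle := hasSum_le (fun k => ?_) (hasSum_tan h0 h1) h
  · refine hle.trans_eq ?_
    field_simp
  · have hk := four_mul_sq_lt_odd_sq h0 h1 k
    have : (1 : ℝ) ≤ (2 * (k : ℝ) + 1) ^ 2 := one_le_pow₀ (by linarith [k.cast_nonneg (α := ℝ)])
    rw [div_mul_div_comm, mul_one]
    refine div_le_div_of_nonneg_left (by positivity) (by positivity) ?_
    nlinarith [sq_nonneg x]

/-- A refinement of the Becker-Stark lower bound for the tangent. -/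
lemma le_tan_becker_stark {x : ℝ} (h0 : 0 < x) (h1 : x < π / 2) :
    8 * x / (π ^ 2 - 4 * x ^ 2) + (1 - 8 / π ^ 2) * x ≤ tan x := by
  have hπ := pi_pos
  have hT := (hasSum_nat_add_iff' 1).2 (hasSum_tan h0 h1)
  have hO := ((hasSum_nat_add_iff' 1).2 hasSum_one_div_odd_sq).mul_left (8 * x / π ^ 2)
  have hle := hasSum_le (fun k => ?_) hO hT
  · simp only [Finset.sum_range_one, Nat.cast_zero, mul_zero, zero_add, one_pow, one_mul,
      div_one] at hle
    have : 8 * x / π ^ 2 * (π ^ 2 / 8 - 1) = (1 - 8 / π ^ 2) * x := by field_simp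
    linarith
  · have hk := four_mul_sq_lt_odd_sq h0 h1 (k + 1)
    rw [div_mul_div_comm, mul_one]
    refine div_le_div_of_nonneg_left (by positivity) hk ?_
    nlinarith [sq_nonneg x]

/-- For every `a > 0` and `α > 0`, the first Robin eigenvalue `λ₁(a,α)`, i.e. the unique
`λ ∈ (0, π²/a²)` satisfying `α = √λ · tan(a√λ/2)`, satisfies
`2απ²/(a(π² + 2αa)) ≤ λ₁(a,α) ≤ (π²/a²)·(π² + 2aα − √(64aα + (π² − 2aα)²))/(2(π² − 8))`. -/
theorem first_robin_eigenvalue_two_sided' (a α lam : ℝ) (ha : 0 < a) (hα : 0 < α)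
    (hmem : lam ∈ Set.Ioo 0 (π ^ 2 / a ^ 2))
    (heq : α = Real.sqrt lam * Real.tan (a * Real.sqrt lam / 2)) :
    2 * α * π ^ 2 / (a * (π ^ 2 + 2 * α * a)) ≤ lam ∧
      lam ≤ π ^ 2 / a ^ 2 *
        ((π ^ 2 + 2 * a * α - Real.sqrt (64 * a * α + (π ^ 2 - 2 * a * α) ^ 2)) /
          (2 * (π ^ 2 - 8))) := by
  have hπ := pi_pos
  have hπ8 : 0 < π ^ 2 - 8 := by nlinarith [pi_gt_three]
  obtain ⟨hl0, hl1⟩ := hmem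
  have hs0 : 0 < √lam := sqrt_pos.2 hl0
  have hlam : √lam ^ 2 = lam := sq_sqrt hl0.le
  obtain ⟨x, hx⟩ : ∃ x, x = a * √lam / 2 := ⟨_, rfl⟩
  have hx0 : 0 < x := by rw [hx]; positivity
  have hxlam : 4 * x ^ 2 = a ^ 2 * lam := by
    rw [hx]; linear_combination a ^ 2 * hlam
  have hx1 : 4 * x ^ 2 < π ^ 2 := by
    rw [hxlam]
    rw [lt_div_iff₀ (by positivity)] at hl1
    linarith
  have hx2 : x < π / 2 := by nlinarith
  have hd : 0 < π ^ 2 - 4 * x ^ 2 := by linarith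
  have hT : a * α = 2 * x * tan x := by
    rw [← hx] at heq
    rw [heq, hx]; ring
  have hT0 : 0 < a * α := by positivity
  obtain ⟨T, hTdef⟩ : ∃ T, T = a * α := ⟨_, rfl⟩
  have hup := tan_le_becker_stark hx0 hx2
  have hlo := le_tan_becker_stark hx0 hx2
  rw [le_div_iff₀ hd] at hup
  constructor
  · rw [div_le_iff₀ (by positivity)]
    have h : 2 * (a * α) * (π ^ 2 - 4 * x ^ 2) ≤ 4 * x ^ 2 * π ^ 2 := by
      rw [hT]; nlinarith
    rw [hxlam] at h
    refine le_of_mul_le_mul_left ?_ ha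
    linarith
  · have h64 : 64 * a * α = 64 * T := by rw [hTdef]; ring
    have h2 : 2 * a * α = 2 * T := by rw [hTdef]; ring
    rw [h64, h2]
    rw [← hTdef] at hT hT0
    obtain ⟨s, hs⟩ : ∃ s, s = 4 * x ^ 2 / π ^ 2 := ⟨_, rfl⟩
    have hs1 : s < 1 := by rw [hs, div_lt_one (by positivity)]; exact hx1
    have hspos : 0 < s := by rw [hs]; positivity
    have hxs : 4 * x ^ 2 = s * π ^ 2 := by rw [hs]; field_simp
    have hlams : lam = π ^ 2 / a ^ 2 * s := by
      rw [hs, hxlam]; field_simp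
    rw [hlams]
    refine mul_le_mul_of_nonneg_left ?_ (by positivity)
    have hquad : π ^ 2 * s - (π ^ 2 - 8) * s ^ 2 ≤ 2 * T * (1 - s) := by
      rw [hxs] at hlo
      have h1s : 0 < 1 - s := by linarith
      have e : 8 * x / (π ^ 2 - s * π ^ 2) + (1 - 8 / π ^ 2) * x
          = x * (π ^ 2 - (π ^ 2 - 8) * s) / (π ^ 2 * (1 - s)) := by
        have : π ^ 2 - s * π ^ 2 = π ^ 2 * (1 - s) := by ring
        rw [this]
        field_simp
        ring
      rw [e, div_le_iff₀ (by positivity)] at hlo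
      have h4 := mul_le_mul_of_nonneg_left hlo (show 0 ≤ 4 * x by positivity)
      have h5 : π ^ 2 * (π ^ 2 * s - (π ^ 2 - 8) * s ^ 2) ≤ π ^ 2 * (2 * T * (1 - s)) := by
        have e5 : π ^ 2 * (π ^ 2 * s - (π ^ 2 - 8) * s ^ 2)
            = 4 * x * (x * (π ^ 2 - (π ^ 2 - 8) * s)) := by
          linear_combination -(π ^ 2 - (π ^ 2 - 8) * s) * hxs
        rw [e5, hT]
        linarith
      exact le_of_mul_le_mul_left h5 (by positivity)
    rw [le_div_iff₀ (by positivity)]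
    have hsq : √(64 * T + (π ^ 2 - 2 * T) ^ 2) ≤ π ^ 2 + 2 * T - s * (2 * (π ^ 2 - 8)) := by
      refine sqrt_le_iff.2 ⟨?_, ?_⟩
      · have h1s : 0 < 1 - s := by linarith
        refine nonneg_of_mul_nonneg_left ?_ h1s
        nlinarith [mul_nonneg hπ8.le (sq_nonneg (1 - s))]
      · nlinarith
    linarith
end

section
/- Fix α > 0. For every a > 0, the function a ↦ λ₁(a,α) is differentiable at a with derivative equal to −2·λ₁(a,α)·α / (2·sin²((a/2)·√λ₁(a,α)) + aα), which is strictly negative; in particular a ↦ λ₁(a,α) is strictly decreasing on (0,∞). -/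
open Real

/-- The length of the interval whose first Robin eigenvalue with parameter `α` is `x`. -/
noncomputable def robinLength (α x : ℝ) : ℝ := 2 * arctan (α / √x) / √x

theorem robinLength_pos {α x : ℝ} (hα : 0 < α) (hx : 0 < x) : 0 < robinLength α x := by
  have hs := Real.sqrt_pos.2 hx
  have h := Real.arctan_pos.2 (div_pos hα hs)
  unfold robinLength
  positivity

theorem robinLength_strictAntiOn {α : ℝ} (hα : 0 < α) :
    StrictAntiOn (robinLength α) (Set.Ioi 0) := by
  intro x (hx : 0 < x) y (hy : 0 < y) hxy
  have hsx := Real.sqrt_pos.2 hx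
  have hs : √x < √y := Real.sqrt_lt_sqrt hx.le hxy
  have h1 : arctan (α / √y) < arctan (α / √x) :=
    arctan_strictMono (div_lt_div_of_pos_left hα hsx hs)
  have h0 := Real.arctan_pos.2 (div_pos hα (hsx.trans hs))
  unfold robinLength
  exact div_lt_div₀ (by linarith) hs.le (by linarith) hsx

theorem hasDerivAt_robinLength {α x : ℝ} (hx : 0 < x) :
    HasDerivAt (robinLength α) (-(robinLength α x + 2 * α / (x + α ^ 2)) / (2 * x)) x := by
  have hs := Real.sqrt_pos.2 hx
  have hsq := Real.hasDerivAt_sqrt hx.ne'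
  have h := ((((hasDerivAt_const x α).fun_div hsq hs.ne').arctan).const_mul 2).fun_div hsq hs.ne'
  refine h.congr_deriv ?_
  have hxs : x = √x ^ 2 := (Real.sq_sqrt hx.le).symm
  unfold robinLength
  generalize √x = s at hs hxs ⊢
  subst hxs
  have h1 : s ^ 2 + α ^ 2 ≠ 0 := by positivity
  have h2 : 1 + (α / s) ^ 2 = (s ^ 2 + α ^ 2) / s ^ 2 := by field_simp
  rw [h2]
  field_simp
  ring

theorem arctan_div_sqrt_eq {α a x : ℝ} (ha : 0 < a) (hx : x ∈ Set.Ioo 0 (π ^ 2 / a ^ 2))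
    (h : α = √x * tan (a * √x / 2)) : arctan (α / √x) = a * √x / 2 := by
  have hs := Real.sqrt_pos.2 hx.1
  have hlt : √x < π / a := by
    rw [Real.sqrt_lt' (by positivity), div_pow]
    exact hx.2
  have hlt' : a * √x < π := by rwa [lt_div_iff₀' ha] at hlt
  have hpos : 0 < a * √x := by positivity
  have h1 : α / √x = tan (a * √x / 2) := by
    rw [div_eq_iff hs.ne', mul_comm]
    exact h
  rw [h1, arctan_tan (by linarith [pi_pos]) (by linarith)]

theorem robinLength_eq {α a x : ℝ} (ha : 0 < a) (hx : x ∈ Set.Ioo 0 (π ^ 2 / a ^ 2))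
    (h : α = √x * tan (a * √x / 2)) : robinLength α x = a := by
  have hs := Real.sqrt_pos.2 hx.1
  rw [robinLength, arctan_div_sqrt_eq ha hx h]
  field_simp

theorem sin_sq_half_mul_sqrt_eq {α a x : ℝ} (ha : 0 < a) (hx : x ∈ Set.Ioo 0 (π ^ 2 / a ^ 2))
    (h : α = √x * tan (a * √x / 2)) : sin (a / 2 * √x) ^ 2 = α ^ 2 / (x + α ^ 2) := by
  have hx0 : 0 < x := hx.1
  have hs := Real.sqrt_pos.2 hx0
  rw [show a / 2 * √x = arctan (α / √x) by rw [arctan_div_sqrt_eq ha hx h]; ring,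
    sin_sq, cos_sq_arctan, div_pow, Real.sq_sqrt hx0.le]
  have h1 : x + α ^ 2 ≠ 0 := by positivity
  field_simp
  ring

/-- Fix `α > 0`, and let `lam1 a = λ₁(a,α)` denote the first Robin eigenvalue of an interval
of length `a`, i.e. the unique `λ ∈ (0, π²/a²)` with `α = √λ · tan(a√λ/2)`. Then for every
`a > 0`, `lam1` is differentiable at `a` with derivative
`−2·λ₁(a,α)·α / (2·sin²((a/2)·√λ₁(a,α)) + aα)`, which is strictly negative; in particular
`lam1` is strictly decreasing on `(0,∞)`. -/
theorem first_robin_eigenvalue_deriv (α : ℝ) (hα : 0 < α) (lam1 : ℝ → ℝ)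
    (hlam : ∀ a : ℝ, 0 < a → lam1 a ∈ Set.Ioo 0 (π ^ 2 / a ^ 2) ∧
      α = Real.sqrt (lam1 a) * Real.tan (a * Real.sqrt (lam1 a) / 2)) :
    (∀ a : ℝ, 0 < a →
      HasDerivAt lam1
        (-(2 * lam1 a * α) / (2 * Real.sin (a / 2 * Real.sqrt (lam1 a)) ^ 2 + a * α)) a ∧
      -(2 * lam1 a * α) / (2 * Real.sin (a / 2 * Real.sqrt (lam1 a)) ^ 2 + a * α) < 0) ∧
    StrictAntiOn lam1 (Set.Ioi 0) := by
  have hpos : ∀ a, 0 < a → 0 < lam1 a := fun a ha => (hlam a ha).1.1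
  have hinv : ∀ a, 0 < a → robinLength α (lam1 a) = a := fun a ha =>
    robinLength_eq ha (hlam a ha).1 (hlam a ha).2
  have hR := robinLength_strictAntiOn hα
  have hanti : StrictAntiOn lam1 (Set.Ioi 0) := by
    intro a (ha : 0 < a) b (hb : 0 < b) hab
    rw [← hR.lt_iff_gt (hpos a ha) (hpos b hb), hinv a ha, hinv b hb]
    exact hab
  have himage : (fun a => -lam1 a) '' Set.Ioi 0 = Set.Iio 0 := by
    ext t
    constructor
    · rintro ⟨a, ha, rfl⟩
      exact neg_lt_zero.2 (hpos a ha)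
    · intro (ht : t < 0)
      have ht' : 0 < -t := neg_pos.2 ht
      have hl := robinLength_pos hα ht'
      exact ⟨_, hl, by simp [hR.injOn (hpos _ hl) ht' (hinv _ hl)]⟩
  refine ⟨fun a ha => ?_, hanti⟩
  have hx := hpos a ha
  have hcont : ContinuousAt lam1 a := by
    have h : ContinuousAt (fun a => -lam1 a) a :=
      StrictMonoOn.continuousAt_of_image_mem_nhds (s := Set.Ioi 0) hanti.neg (Ioi_mem_nhds ha)
        (by rw [himage]; exact Iio_mem_nhds (neg_lt_zero.2 hx))
    exact h.neg.congr (.of_forall fun b => neg_neg (lam1 b))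
  constructor
  · have hd := hasDerivAt_robinLength (α := α) hx
    rw [hinv a ha] at hd
    have hne : -(a + 2 * α / (lam1 a + α ^ 2)) / (2 * lam1 a) ≠ 0 :=
      div_ne_zero (neg_ne_zero.2 (by positivity)) (by positivity)
    refine (hd.of_local_left_inverse hcont hne ?_).congr_deriv ?_
    · filter_upwards [Ioi_mem_nhds ha] with b hb using hinv b hb
    · rw [sin_sq_half_mul_sqrt_eq ha (hlam a ha).1 (hlam a ha).2]
      field_simp
      ring
  · exact div_neg_of_neg_of_pos (neg_lt_zero.2 (by positivity)) (by positivity)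
end

section
/- For every α > 0 and every a ≥ 1, the first Robin eigenvalue satisfies the scaling estimates λ₁(a,α) ≤ a⁻¹·λ₁(1,α) and λ₁(1/a,α) ≥ a·λ₁(1,α). -/
open Real

lemma mul_sin_le_mul_sin {u v : ℝ} (hu : 0 ≤ u) (huv : u ≤ v) (hv : v ≤ π) :
    u * sin v ≤ v * sin u := by
  rcases (hu.trans huv).eq_or_lt with h | h
  · have : u = 0 := by linarith
    simp [this, ← h]
  · have key := strictConcaveOn_sin_Icc.concaveOn.2 (show v ∈ Set.Icc 0 π from ⟨h.le, hv⟩)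
      (show (0 : ℝ) ∈ Set.Icc 0 π from ⟨le_rfl, pi_pos.le⟩) (show 0 ≤ u / v by positivity)
      (sub_nonneg.2 ((div_le_one h).2 huv)) (add_sub_cancel _ _)
    simp only [smul_eq_mul, sin_zero, mul_zero, add_zero] at key
    rw [div_mul_cancel₀ _ h.ne', div_mul_eq_mul_div, div_le_iff₀ h] at key
    linarith

lemma mul_tan_le_mul_tan {x y : ℝ} (hx : 0 < x) (hxy : x ≤ y) (hy : y < π / 2) :
    y * tan x ≤ x * tan y := by
  have hcx : 0 < cos x := cos_pos_of_mem_Ioo ⟨by linarith [pi_pos], by linarith⟩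
  have hcy : 0 < cos y := cos_pos_of_mem_Ioo ⟨by linarith [pi_pos], hy⟩
  have h := mul_sin_le_mul_sin (u := y - x) (v := x + y) (by linarith) (by linarith) (by linarith)
  rw [sin_add, sin_sub] at h
  rw [tan_eq_sin_div_cos, tan_eq_sin_div_cos, ← mul_div_assoc, ← mul_div_assoc,
    div_le_div_iff₀ hcx hcy]
  linarith

/-- The product of the length and the first Robin eigenvalue is antitone in the length. -/
lemma length_mul_robin_eigenvalue_le {α b c l m : ℝ} (hb : 0 < b) (hbc : b ≤ c)
    (hl : l ∈ Set.Ioo 0 (π ^ 2 / b ^ 2)) (hlα : α = √l * tan (b * √l / 2))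
    (hm : m ∈ Set.Ioo 0 (π ^ 2 / c ^ 2)) (hmα : α = √m * tan (c * √m / 2)) :
    c * m ≤ b * l := by
  have hc : 0 < c := hb.trans_le hbc
  have angle_lt : ∀ {d k : ℝ}, 0 < d → k ∈ Set.Ioo 0 (π ^ 2 / d ^ 2) → d * √k / 2 < π / 2 := by
    intro d k hd hk
    have h : √k < π / d := by
      rw [sqrt_lt' (by positivity), div_pow]
      exact hk.2
    rw [lt_div_iff₀ hd] at h
    linarith
  have hs : 0 < √l := sqrt_pos.2 hl.1
  have hr : 0 < √m := sqrt_pos.2 hm.1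
  have hx : 0 < b * √l / 2 := by positivity
  have hy : 0 < c * √m / 2 := by positivity
  have hx2 := angle_lt hb hl
  have hy2 := angle_lt hc hm
  have hl2 := sq_sqrt hl.1.le
  have hm2 := sq_sqrt hm.1.le
  have htx := tan_pos_of_pos_of_lt_pi_div_two hx hx2
  have hα : 0 < α := hlα ▸ mul_pos hs htx
  have hxy : b * √l / 2 ≤ c * √m / 2 := by
    by_contra! h
    have ht := tan_lt_tan_of_nonneg_of_lt_pi_div_two hy.le hx2 h
    have h1 : (c * √m / 2) * tan (c * √m / 2) < (b * √l / 2) * tan (b * √l / 2) :=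
      mul_lt_mul'' h ht hy.le (tan_pos_of_pos_of_lt_pi_div_two hy hy2).le
    have h2 : c * α < b * α := by
      linear_combination 2 * h1 + c * hmα - b * hlα
    exact absurd (lt_of_mul_lt_mul_right h2 hα.le) hbc.not_gt
  have h := mul_tan_le_mul_tan hx hxy hy2
  rw [show tan (b * √l / 2) = α / √l by rw [eq_div_iff hs.ne']; linarith,
    show tan (c * √m / 2) = α / √m by rw [eq_div_iff hr.ne']; linarith,
    ← mul_div_assoc, ← mul_div_assoc, div_le_div_iff₀ hs hr] at h
  rw [← hl2, ← hm2]
  refine le_of_mul_le_mul_right ?_ hα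
  linarith

/-- Let `lam1 a α = λ₁(a,α)` denote the first Robin eigenvalue of an interval of length
`a > 0` with boundary parameter `α > 0`, i.e. the unique `λ ∈ (0, π²/a²)` with
`α = √λ · tan(a√λ/2)`. Then for every `α > 0` and every `a ≥ 1` one has
`λ₁(a,α) ≤ a⁻¹·λ₁(1,α)` and `λ₁(1/a,α) ≥ a·λ₁(1,α)`. -/
theorem first_robin_eigenvalue_scaling (lam1 : ℝ → ℝ → ℝ)
    (hlam : ∀ a α : ℝ, 0 < a → 0 < α → lam1 a α ∈ Set.Ioo 0 (π ^ 2 / a ^ 2) ∧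
      α = Real.sqrt (lam1 a α) * Real.tan (a * Real.sqrt (lam1 a α) / 2))
    (α : ℝ) (hα : 0 < α) (a : ℝ) (ha : 1 ≤ a) :
    lam1 a α ≤ a⁻¹ * lam1 1 α ∧ a * lam1 1 α ≤ lam1 (1 / a) α := by
  have ha0 : 0 < a := one_pos.trans_le ha
  have hi0 : 0 < 1 / a := one_div_pos.2 ha0
  obtain ⟨h1, e1⟩ := hlam 1 α one_pos hα
  obtain ⟨h2, e2⟩ := hlam a α ha0 hα
  obtain ⟨h3, e3⟩ := hlam (1 / a) α hi0 hα
  constructor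
  · have h := length_mul_robin_eigenvalue_le one_pos ha h1 e1 h2 e2
    rw [inv_mul_eq_div, le_div_iff₀ ha0]
    linarith
  · have h := length_mul_robin_eigenvalue_le hi0 ((div_le_one ha0).2 ha) h3 e3 h1 e1
    rw [one_mul, one_div_mul_eq_div, le_div_iff₀ ha0] at h
    linarith
end

section
/- For every α > 0 and every a ≥ 1, one has λ₁(1/a,α) ≤ a⁴·λ₁(a,α); consequently, sin²((1/(2a))·√λ₁(1/a,α)) ≤ sin²((a/2)·√λ₁(a,α)). -/
open Real

/-- Half the interval length times the square root of an eigenvalue below `π² / a²` lies in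
`(0, π / 2)`. -/
theorem half_mul_sqrt_mem_Ioo {a l : ℝ} (ha : 0 < a) (hl : l ∈ Set.Ioo 0 (π ^ 2 / a ^ 2)) :
    a * √l / 2 ∈ Set.Ioo 0 (π / 2) := by
  have hs : 0 < √l := Real.sqrt_pos.2 hl.1
  have hlt : √l < π / a := by
    rw [Real.sqrt_lt' (div_pos pi_pos ha), div_pow]
    exact hl.2
  rw [lt_div_iff₀ ha] at hlt
  exact ⟨by positivity, by linarith⟩

/-- Let `lam1 a α = λ₁(a,α)` denote the first Robin eigenvalue of an interval of length
`a > 0` with boundary parameter `α > 0`, i.e. the unique `λ ∈ (0, π²/a²)` with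
`α = √λ · tan(a√λ/2)`. Then for every `α > 0` and every `a ≥ 1` one has
`λ₁(1/a,α) ≤ a⁴·λ₁(a,α)`, and consequently
`sin²((1/(2a))·√λ₁(1/a,α)) ≤ sin²((a/2)·√λ₁(a,α))`. -/
theorem first_robin_eigenvalue_sine_comparison (lam1 : ℝ → ℝ → ℝ)
    (hlam : ∀ a α : ℝ, 0 < a → 0 < α → lam1 a α ∈ Set.Ioo 0 (π ^ 2 / a ^ 2) ∧
      α = Real.sqrt (lam1 a α) * Real.tan (a * Real.sqrt (lam1 a α) / 2))
    (α : ℝ) (hα : 0 < α) (a : ℝ) (ha : 1 ≤ a) :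
    lam1 (1 / a) α ≤ a ^ 4 * lam1 a α ∧
      Real.sin (1 / (2 * a) * Real.sqrt (lam1 (1 / a) α)) ^ 2 ≤
        Real.sin (a / 2 * Real.sqrt (lam1 a α)) ^ 2 := by
  have ha0 : 0 < a := by linarith
  obtain ⟨hs, hsα⟩ := hlam a α ha0 hα
  obtain ⟨ht, htα⟩ := hlam (1 / a) α (by positivity) hα
  have hu := half_mul_sqrt_mem_Ioo ha0 hs
  have hv := half_mul_sqrt_mem_Ioo (by positivity) ht
  have hs_sq := Real.sq_sqrt hs.1.le
  have ht_sq := Real.sq_sqrt ht.1.le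
  have hs0 := Real.sqrt_pos.2 hs.1
  have ht0 := Real.sqrt_pos.2 ht.1
  set s := √(lam1 a α)
  set t := √(lam1 (1 / a) α)
  have ht_eq : t = a * (2 * (1 / a * t / 2)) := by field_simp
  have hle : 1 / a * t / 2 ≤ a * s / 2 := by
    by_contra! h
    have htan : tan (a * s / 2) < tan (1 / a * t / 2) :=
      tan_lt_tan_of_nonneg_of_lt_pi_div_two hu.1.le hv.2 h
    have hst : s < t := by
      have h₁ : a * (a * s) < t := by
        rw [ht_eq]
        exact mul_lt_mul_of_pos_left (by linarith) ha0
      nlinarith [mul_le_mul_of_nonneg_right ha hs0.le]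
    have htan0 := tan_pos_of_pos_of_lt_pi_div_two hu.1 hu.2
    exact (mul_lt_mul'' hst htan hs0.le htan0.le).ne (hsα.symm.trans htα)
  constructor
  · have hts : t ≤ a ^ 2 * s := by
      rw [ht_eq]
      nlinarith
    calc lam1 (1 / a) α = t ^ 2 := ht_sq.symm
      _ ≤ (a ^ 2 * s) ^ 2 := pow_le_pow_left₀ ht0.le hts 2
      _ = a ^ 4 * lam1 a α := by rw [← hs_sq]; ring
  · rw [show 1 / (2 * a) * t = 1 / a * t / 2 by field_simp,
      show a / 2 * s = a * s / 2 by ring]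
    exact pow_le_pow_left₀
      (sin_nonneg_of_nonneg_of_le_pi hv.1.le (by linarith [hv.2, pi_pos]))
      (sin_le_sin_of_le_of_le_pi_div_two (by linarith [hv.1, pi_pos]) hu.2.le hle) 2
end

section
/- Fix A > 0 and α > 0. For every aspect ratio a ≥ 1, the first Robin eigenvalue of the rectangle with side lengths √A·a and √A/a, which equals λ₁(√A·a, α) + λ₁(√A/a, α), satisfies λ₁(√A·a, α) + λ₁(√A/a, α) ≥ 2·λ₁(√A, α), with equality if and only if a = 1. (The square minimises the first Robin eigenvalue among all rectangles of area A.) -/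
open Real

/-- Elementary lower bound for `arctan`, equivalent to `sin (2 * y) ≤ 2 * y` at `y = arctan x`. -/
lemma div_one_add_sq_le_arctan {x : ℝ} (hx : 0 ≤ x) : x / (1 + x ^ 2) ≤ arctan x := by
  have h := Real.sin_le (x := 2 * arctan x) (by have := Real.arctan_nonneg.2 hx; linarith)
  have hp : 0 < 1 + x ^ 2 := by positivity
  rw [Real.sin_two_mul, Real.sin_arctan, Real.cos_arctan] at h
  have e : 2 * (x / √(1 + x ^ 2)) * (1 / √(1 + x ^ 2)) = 2 * (x / (1 + x ^ 2)) := by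
    have : √(1 + x ^ 2) * √(1 + x ^ 2) = 1 + x ^ 2 := Real.mul_self_sqrt hp.le
    rw [mul_assoc, div_mul_div_comm, this, mul_one]
  linarith

lemma hasDerivAt_arctan_div_sqrt (α : ℝ) {t : ℝ} (ht : 0 < t) :
    HasDerivAt (fun t => arctan (α / √t)) (-(α / (2 * √t * (t + α ^ 2)))) t := by
  have hs : 0 < √t := Real.sqrt_pos.2 ht
  have h := (((Real.hasDerivAt_sqrt ht.ne').inv hs.ne').const_mul α).arctan
  simp only [Pi.inv_apply, ← div_eq_mul_inv] at h
  convert h using 1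
  have e : t = √t ^ 2 := (Real.sq_sqrt ht.le).symm
  set s := √t
  rw [e]
  field_simp

lemma monotoneOn_sqrt_mul_arctan_div_sqrt {α : ℝ} (hα : 0 < α) :
    MonotoneOn (fun t => √t * arctan (α / √t)) (Set.Ioi 0) := by
  have hd : ∀ t ∈ Set.Ioi (0 : ℝ), HasDerivAt (fun t => √t * arctan (α / √t))
      (1 / (2 * √t) * arctan (α / √t) + √t * -(α / (2 * √t * (t + α ^ 2)))) t :=
    fun t ht => (Real.hasDerivAt_sqrt (ne_of_gt ht)).mul (hasDerivAt_arctan_div_sqrt α ht)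
  refine monotoneOn_of_deriv_nonneg (convex_Ioi 0)
    (fun t ht => (hd t ht).continuousAt.continuousWithinAt) ?_ ?_
  · rw [interior_Ioi]
    exact fun t ht => (hd t ht).differentiableAt.differentiableWithinAt
  · rw [interior_Ioi]
    intro t ht
    rw [(hd t ht).deriv]
    have ht' : 0 < t := ht
    have hs : 0 < √t := Real.sqrt_pos.2 ht'
    have h := div_one_add_sq_le_arctan (div_pos hα hs).le
    have e : 1 / (2 * √t) * arctan (α / √t) + √t * -(α / (2 * √t * (t + α ^ 2)))
        = 1 / (2 * √t) * (arctan (α / √t) - α / √t / (1 + (α / √t) ^ 2)) := by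
      have e : t = √t ^ 2 := (Real.sq_sqrt ht'.le).symm
      set s := √t
      rw [e]
      field_simp
      ring
    rw [e]
    exact mul_nonneg (by positivity) (sub_nonneg.2 h)

lemma convexOn_log_arctan_div_sqrt {α : ℝ} (hα : 0 < α) :
    ConvexOn ℝ (Set.Ioi 0) (fun t => log (arctan (α / √t))) := by
  have hpos : ∀ t ∈ Set.Ioi (0 : ℝ), 0 < arctan (α / √t) :=
    fun t ht => Real.arctan_pos.2 (div_pos hα (Real.sqrt_pos.2 ht))
  have hd : ∀ t ∈ Set.Ioi (0 : ℝ), HasDerivAt (fun t => log (arctan (α / √t)))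
      (-(α / (2 * √t * (t + α ^ 2))) / arctan (α / √t)) t :=
    fun t ht => (hasDerivAt_arctan_div_sqrt α ht).log (hpos t ht).ne'
  refine MonotoneOn.convexOn_of_deriv (convex_Ioi 0)
    (fun t ht => (hd t ht).continuousAt.continuousWithinAt) ?_ ?_
  · rw [interior_Ioi]
    exact fun t ht => (hd t ht).differentiableAt.differentiableWithinAt
  · rw [interior_Ioi]
    intro p hp q hq hpq
    rw [(hd p hp).deriv, (hd q hq).deriv, neg_div, neg_div, neg_le_neg_iff, div_div, div_div]
    have hm := monotoneOn_sqrt_mul_arctan_div_sqrt hα hp hq hpq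
    have hp' : 0 < p := hp
    have hM : 0 < √p * arctan (α / √p) := mul_pos (Real.sqrt_pos.2 hp) (hpos p hp)
    have hmul := mul_le_mul hm (add_le_add_left hpq (α ^ 2)) (by positivity)
      (hM.le.trans hm)
    have hD : 0 < (√p * arctan (α / √p)) * (p + α ^ 2) := by positivity
    refine div_le_div_of_nonneg_left hα.le (by linarith) (by linarith)

/-- The logarithm of the half-length of the interval whose first Robin eigenvalue is `t`. -/
noncomputable def logHalfLength (α t : ℝ) : ℝ := log (arctan (α / √t)) - log t / 2

lemma strictConvexOn_logHalfLength {α : ℝ} (hα : 0 < α) :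
    StrictConvexOn ℝ (Set.Ioi 0) (logHalfLength α) := by
  refine ⟨convex_Ioi 0, fun x hx y hy hxy a b ha hb hab => ?_⟩
  have h1 := (convexOn_log_arctan_div_sqrt hα).2 hx hy ha.le hb.le hab
  have h2 := strictConcaveOn_log_Ioi.2 hx hy hxy ha hb hab
  simp only [logHalfLength, smul_eq_mul] at *
  linarith

lemma strictAntiOn_logHalfLength {α : ℝ} (hα : 0 < α) :
    StrictAntiOn (logHalfLength α) (Set.Ioi 0) := by
  intro x hx y hy hxy
  have hsx : 0 < √x := Real.sqrt_pos.2 hx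
  have hsy : 0 < √y := Real.sqrt_pos.2 hy
  have h1 : log (arctan (α / √y)) ≤ log (arctan (α / √x)) :=
    log_le_log (Real.arctan_pos.2 (by positivity)) (Real.arctan_strictMono.monotone
      (div_le_div_of_nonneg_left hα.le hsx (Real.sqrt_le_sqrt hxy.le)))
  have h2 := log_lt_log hx hxy
  simp only [logHalfLength]
  linarith

lemma logHalfLength_eq_of_robin {l α t : ℝ} (hl : 0 < l) (ht : t ∈ Set.Ioo 0 (π ^ 2 / l ^ 2))
    (h : α = √t * tan (l * √t / 2)) : logHalfLength α t = log (l / 2) := by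
  have hs : 0 < √t := Real.sqrt_pos.2 ht.1
  have hlt : l * √t < π := by
    have h1 : √t < π / l := by
      rw [Real.sqrt_lt' (by positivity), div_pow]
      exact ht.2
    rwa [lt_div_iff₀ hl, mul_comm] at h1
  have harc : arctan (α / √t) = l * √t / 2 := by
    have h0 : 0 < l * √t := by positivity
    rw [h, mul_div_cancel_left₀ _ hs.ne', Real.arctan_tan] <;> linarith
  rw [logHalfLength, harc, ← Real.log_sqrt ht.1.le,
    ← Real.log_div (by positivity) hs.ne']
  congr 1
  field_simp

/-- Let `lam1 a α = λ₁(a,α)` denote the first Robin eigenvalue of an interval of length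
`a > 0` with boundary parameter `α > 0`, i.e. the unique `λ ∈ (0, π²/a²)` with
`α = √λ · tan(a√λ/2)`. Fix `A > 0` and `α > 0`. For every aspect ratio `a ≥ 1`, the first
Robin eigenvalue of the rectangle with side lengths `√A·a` and `√A/a`, which equals
`λ₁(√A·a, α) + λ₁(√A/a, α)`, satisfies
`λ₁(√A·a, α) + λ₁(√A/a, α) ≥ 2·λ₁(√A, α)`, with equality iff `a = 1`. -/
theorem square_minimises_first_eigenvalue_rectangles (lam1 : ℝ → ℝ → ℝ)
    (hlam : ∀ a α : ℝ, 0 < a → 0 < α → lam1 a α ∈ Set.Ioo 0 (π ^ 2 / a ^ 2) ∧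
      α = Real.sqrt (lam1 a α) * Real.tan (a * Real.sqrt (lam1 a α) / 2))
    (A α : ℝ) (hA : 0 < A) (hα : 0 < α) (a : ℝ) (ha : 1 ≤ a) :
    2 * lam1 (Real.sqrt A) α ≤ lam1 (Real.sqrt A * a) α + lam1 (Real.sqrt A / a) α ∧
      (lam1 (Real.sqrt A * a) α + lam1 (Real.sqrt A / a) α = 2 * lam1 (Real.sqrt A) α ↔
        a = 1) := by
  rcases ha.eq_or_lt with rfl | ha1
  · simp only [mul_one, div_one]
    exact ⟨by linarith, by simp; ring⟩
  have ha0 : 0 < a := by linarith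
  have hS : 0 < √A := Real.sqrt_pos.2 hA
  have key : ∀ l : ℝ, 0 < l → 0 < lam1 l α ∧ logHalfLength α (lam1 l α) = log (l / 2) :=
    fun l hl => ⟨(hlam l α hl hα).1.1,
      logHalfLength_eq_of_robin hl (hlam l α hl hα).1 (hlam l α hl hα).2⟩
  obtain ⟨p0, e0⟩ := key (√A) hS
  obtain ⟨p1, e1⟩ := key (√A * a) (by positivity)
  obtain ⟨p2, e2⟩ := key (√A / a) (by positivity)
  have hlog : 0 < log a := Real.log_pos ha1
  rw [Real.log_div (by positivity) two_ne_zero] at e0 e1 e2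
  rw [Real.log_mul hS.ne' ha0.ne'] at e1
  rw [Real.log_div hS.ne' ha0.ne'] at e2
  have hne : lam1 (√A * a) α ≠ lam1 (√A / a) α := fun h => by
    rw [h] at e1
    linarith
  have hJ := (strictConvexOn_logHalfLength hα).2 p1 p2 hne (one_half_pos (α := ℝ))
    one_half_pos (add_halves 1)
  simp only [smul_eq_mul] at hJ
  have hlt : 2 * lam1 (√A) α < lam1 (√A * a) α + lam1 (√A / a) α := by
    have h : logHalfLength α (1 / 2 * lam1 (√A * a) α + 1 / 2 * lam1 (√A / a) α)
        < logHalfLength α (lam1 (√A) α) := by linarith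
    rw [(strictAntiOn_logHalfLength hα).lt_iff_gt (Set.mem_Ioi.2 (by positivity)) p0] at h
    linarith
  exact ⟨hlt.le, fun h => absurd h hlt.ne', fun h => absurd h ha1.ne'⟩
end

section
/- Fix α > 0 and let n ≥ 1 rectangles be given, with areas A₁,…,Aₙ > 0 summing to A and aspect ratios a₁,…,aₙ ≥ 1 (so the i-th rectangle has sides √(Aᵢ)·aᵢ and √(Aᵢ)/aᵢ). Then the minimum over i of λ₁(√(Aᵢ)·aᵢ, α) + λ₁(√(Aᵢ)/aᵢ, α) is at least 2·λ₁(√A, α), with equality if and only if n = 1 and a₁ = 1. (The square minimises the first Robin eigenvalue among all finite disjoint unions of rectangles of total area A.) -/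
open Real

namespace RobinRectangle

open Set

lemma sin_pos_and_cos_pos {x : ℝ} (hx : x ∈ Ioo 0 (π / 2)) : 0 < sin x ∧ 0 < cos x :=
  ⟨sin_pos_of_pos_of_lt_pi hx.1 (by linarith [hx.2, pi_pos]),
    cos_pos_of_mem_Ioo ⟨by linarith [hx.1, pi_pos], hx.2⟩⟩

lemma sin_mul_cos_lt_self {x : ℝ} (hx : x ∈ Ioo 0 (π / 2)) : sin x * cos x < x := by
  have h := sin_lt (x := 2 * x) (by linarith [hx.1])
  rw [sin_two_mul] at h
  linarith

lemma tan_strictMonoOn : StrictMonoOn tan (Ioo 0 (π / 2)) := fun _ hx _ hy hxy =>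
  tan_lt_tan_of_nonneg_of_lt_pi_div_two hx.1.le hy.2 hxy

lemma tan_pos {x : ℝ} (hx : x ∈ Ioo 0 (π / 2)) : 0 < tan x :=
  tan_pos_of_pos_of_lt_pi_div_two hx.1 hx.2

lemma tan_div_self_strictMonoOn : StrictMonoOn (fun x => tan x / x) (Ioo 0 (π / 2)) := by
  have hd : ∀ x ∈ Ioo 0 (π / 2),
      HasDerivAt (fun x => tan x / x) ((1 / cos x ^ 2 * x - tan x * 1) / x ^ 2) x := fun x hx =>
    (hasDerivAt_tan (sin_pos_and_cos_pos hx).2.ne').div (hasDerivAt_id x) hx.1.ne'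
  refine strictMonoOn_of_deriv_pos (convex_Ioo _ _)
    (fun x hx => (hd x hx).continuousAt.continuousWithinAt) fun x hx => ?_
  rw [interior_Ioo] at hx
  rw [(hd x hx).deriv]
  obtain ⟨_, hc⟩ := sin_pos_and_cos_pos hx
  have hx0 := hx.1
  have : 1 / cos x ^ 2 * x - tan x * 1 = (x - sin x * cos x) / cos x ^ 2 := by
    rw [tan_eq_sin_div_cos]
    field_simp
  rw [this]
  have := sub_pos.2 (sin_mul_cos_lt_self hx)
  positivity

/-- With `a = 2 x tan x / α` and `λ = α² / tan² x`, the quantity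
`dλ / d(log a)` equals `-2 α² / slopeInv x`. -/
noncomputable def slopeInv (x : ℝ) : ℝ := tan x ^ 2 + sin x ^ 2 * (tan x / x)

lemma slopeInv_pos {x : ℝ} (hx : x ∈ Ioo 0 (π / 2)) : 0 < slopeInv x := by
  have h1 := (sin_pos_and_cos_pos hx).1
  have h2 := tan_pos hx
  have h3 := hx.1
  unfold slopeInv
  positivity

lemma slopeInv_strictMonoOn : StrictMonoOn slopeInv (Ioo 0 (π / 2)) := by
  intro x hx y hy hxy
  have h1 := tan_strictMonoOn hx hy hxy
  have h2 := tan_pos hx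
  have h3 := tan_div_self_strictMonoOn hx hy hxy
  have h4 := (sin_pos_and_cos_pos hx).1
  have h5 : sin x < sin y := sin_lt_sin_of_lt_of_le_pi_div_two (by linarith [hx.1, pi_pos]) hy.2.le hxy
  have h6 := div_pos h2 hx.1
  unfold slopeInv
  simp only at h3
  gcongr

/-- The eigenvalue `1 / tan² x` minus its tangent line at `c`, as functions of
`log (x tan x)`. -/
noncomputable def tangentGap (c x : ℝ) : ℝ := (tan x ^ 2)⁻¹ + 2 / slopeInv c * log (x * tan x)

lemma hasDerivAt_tangentGap (c : ℝ) {x : ℝ} (hx : x ∈ Ioo 0 (π / 2)) :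
    HasDerivAt (tangentGap c)
      (2 * (1 / x + 1 / (sin x * cos x)) * (1 / slopeInv c - 1 / slopeInv x)) x := by
  obtain ⟨hs, hc⟩ := sin_pos_and_cos_pos hx
  have hx0 := hx.1
  have ht := tan_pos hx
  have hq := slopeInv_pos hx
  have hdt := hasDerivAt_tan hc.ne'
  have h1 := (hdt.pow 2).inv (pow_pos ht 2).ne'
  have h2 := (((hasDerivAt_id x).mul hdt).log (by simp; constructor <;> positivity)).const_mul
    (2 / slopeInv c)
  refine (h1.add h2).congr_deriv ?_
  have hq' : 1 / slopeInv x = x * cos x ^ 2 / (sin x ^ 2 * (x + sin x * cos x)) := by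
    unfold slopeInv
    rw [tan_eq_sin_div_cos]
    field_simp
  rw [hq', tan_eq_sin_div_cos]
  simp only [Pi.mul_apply, id, Pi.pow_apply, Nat.reduceSub, pow_one, Nat.cast_ofNat]
  rw [tan_eq_sin_div_cos]
  have hxs : x + sin x * cos x ≠ 0 := by positivity
  generalize sin x = S at *
  generalize cos x = C at *
  generalize slopeInv c = q
  field_simp
  ring

lemma tangentGap_lt {c x : ℝ} (hc : c ∈ Ioo 0 (π / 2)) (hx : x ∈ Ioo 0 (π / 2)) (hne : x ≠ c) :
    tangentGap c c < tangentGap c x := by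
  have hpos : ∀ y ∈ Ioo 0 (π / 2), 0 < 2 * (1 / y + 1 / (sin y * cos y)) := fun y hy => by
    obtain ⟨hs, hc⟩ := sin_pos_and_cos_pos hy
    have := hy.1
    positivity
  rcases hne.lt_or_gt with h | h
  · have hsub : Icc x c ⊆ Ioo 0 (π / 2) := fun y hy =>
      ⟨hx.1.trans_le hy.1, hy.2.trans_lt hc.2⟩
    refine strictAntiOn_of_deriv_neg (convex_Icc x c) (fun y hy =>
      (hasDerivAt_tangentGap c (hsub hy)).continuousAt.continuousWithinAt) (fun y hy => ?_)
      (left_mem_Icc.2 h.le) (right_mem_Icc.2 h.le) h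
    have hy' := hsub (interior_subset hy)
    rw [interior_Icc] at hy
    rw [(hasDerivAt_tangentGap c hy').deriv]
    exact mul_neg_of_pos_of_neg (hpos y hy') (sub_neg.2
      (one_div_lt_one_div_of_lt (slopeInv_pos hy') (slopeInv_strictMonoOn hy' hc hy.2)))
  · have hsub : Icc c x ⊆ Ioo 0 (π / 2) := fun y hy =>
      ⟨hc.1.trans_le hy.1, hy.2.trans_lt hx.2⟩
    refine strictMonoOn_of_deriv_pos (convex_Icc c x) (fun y hy =>
      (hasDerivAt_tangentGap c (hsub hy)).continuousAt.continuousWithinAt) (fun y hy => ?_)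
      (left_mem_Icc.2 h.le) (right_mem_Icc.2 h.le) h
    have hy' := hsub (interior_subset hy)
    rw [interior_Icc] at hy
    rw [(hasDerivAt_tangentGap c hy').deriv]
    exact mul_pos (hpos y hy') (sub_pos.2
      (one_div_lt_one_div_of_lt (slopeInv_pos hc) (slopeInv_strictMonoOn hc hy' hy.1)))

/-- `l` is a first Robin eigenvalue of an interval of length `a` with boundary parameter `α`. -/
def IsFirstRobin (a α l : ℝ) : Prop :=
  l ∈ Ioo 0 (π ^ 2 / a ^ 2) ∧ α = √l * tan (a * √l / 2)

lemma IsFirstRobin.exists_angle {a α l : ℝ} (ha : 0 < a) (h : IsFirstRobin a α l) :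
    ∃ x ∈ Ioo 0 (π / 2), l = α ^ 2 * (tan x ^ 2)⁻¹ ∧ a * α = 2 * (x * tan x) := by
  obtain ⟨⟨h0, h1⟩, h2⟩ := h
  have hs : 0 < √l := sqrt_pos.2 h0
  have hlt : a * √l < π := by
    refine lt_of_pow_lt_pow_left₀ 2 pi_pos.le ?_
    rw [mul_pow, sq_sqrt h0.le]
    rwa [lt_div_iff₀ (by positivity), mul_comm] at h1
  have hx : a * √l / 2 ∈ Ioo 0 (π / 2) := ⟨by positivity, by linarith⟩
  refine ⟨_, hx, ?_, ?_⟩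
  · have := (tan_pos hx).ne'
    nth_rewrite 1 [h2]
    rw [mul_pow, sq_sqrt h0.le]
    field_simp
  · nth_rewrite 1 [h2]
    ring

lemma IsFirstRobin.lt {a b α l m : ℝ} (hα : 0 < α) (ha : 0 < a) (hl : IsFirstRobin a α l)
    (hm : IsFirstRobin b α m) (hab : a < b) : m < l := by
  obtain ⟨x, hx, rfl, hxa⟩ := hl.exists_angle ha
  obtain ⟨y, hy, rfl, hyb⟩ := hm.exists_angle (ha.trans hab)
  have hxy : x < y := by
    by_contra! hyx
    have h1 := tan_strictMonoOn.monotoneOn hy hx hyx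
    have h2 := mul_le_mul hyx h1 (tan_pos hy).le hx.1.le
    nlinarith
  have h1 := tan_pos hx
  have h2 := tan_strictMonoOn hx hy hxy
  gcongr

lemma IsFirstRobin.two_mul_lt_add {s r α l l₁ l₂ : ℝ} (hα : 0 < α) (hs : 0 < s) (hr : 1 < r)
    (hl : IsFirstRobin s α l) (h₁ : IsFirstRobin (s * r) α l₁) (h₂ : IsFirstRobin (s / r) α l₂) :
    2 * l < l₁ + l₂ := by
  have hr0 : 0 < r := by linarith
  obtain ⟨c, hc, rfl, hcs⟩ := hl.exists_angle hs
  obtain ⟨x, hx, rfl, hxs⟩ := h₁.exists_angle (by positivity)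
  obtain ⟨y, hy, rfl, hys⟩ := h₂.exists_angle (by positivity)
  have hsα : 0 < s * α := by positivity
  have ex : x * tan x = (c * tan c) * r := by linear_combination (r * hcs - hxs) / 2
  have ey : y * tan y = (c * tan c) / r := by linear_combination (hcs / r - hys) / 2
  have hp : 0 < c * tan c := mul_pos hc.1 (tan_pos hc)
  have gx := tangentGap_lt hc hx (by rintro rfl; nlinarith)
  have gy := tangentGap_lt hc hy (by
    rintro rfl
    rw [eq_div_iff hr0.ne'] at ey
    nlinarith)
  unfold tangentGap at gx gy
  rw [ex, log_mul hp.ne' hr0.ne'] at gx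
  rw [ey, log_div hp.ne' hr0.ne'] at gy
  have : 2 * (tan c ^ 2)⁻¹ < (tan x ^ 2)⁻¹ + (tan y ^ 2)⁻¹ := by linarith
  have := mul_lt_mul_of_pos_left this (pow_pos hα 2)
  linarith

end RobinRectangle

open RobinRectangle

/-- Let `lam1 a α = λ₁(a,α)` denote the first Robin eigenvalue of an interval of length
`a > 0` with boundary parameter `α > 0`, i.e. the unique `λ ∈ (0, π²/a²)` with
`α = √λ · tan(a√λ/2)`. Fix `α > 0` and let `n ≥ 1` rectangles be given, with areas
`A 0, …, A (n-1) > 0` and aspect ratios `r 0, …, r (n-1) ≥ 1` (so the `i`-th rectangle has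
sides `√(A i)·r i` and `√(A i)/r i`). Then the minimum over `i` of
`λ₁(√(A i)·r i, α) + λ₁(√(A i)/r i, α)` — the first Robin eigenvalue of the disjoint union
of the rectangles — is at least `2·λ₁(√(∑ i, A i), α)`, with equality iff `n = 1` and all
aspect ratios equal `1`. -/
theorem square_minimises_first_eigenvalue_unions (lam1 : ℝ → ℝ → ℝ)
    (hlam : ∀ a α : ℝ, 0 < a → 0 < α → lam1 a α ∈ Set.Ioo 0 (π ^ 2 / a ^ 2) ∧
      α = Real.sqrt (lam1 a α) * Real.tan (a * Real.sqrt (lam1 a α) / 2))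
    (α : ℝ) (hα : 0 < α) (n : ℕ) (hn : 1 ≤ n) (A r : Fin n → ℝ)
    (hA : ∀ i, 0 < A i) (hr : ∀ i, 1 ≤ r i) (hne : (Finset.univ : Finset (Fin n)).Nonempty) :
    2 * lam1 (Real.sqrt (∑ i, A i)) α ≤
      Finset.univ.inf' hne
        (fun i => lam1 (Real.sqrt (A i) * r i) α + lam1 (Real.sqrt (A i) / r i) α) ∧
    (Finset.univ.inf' hne
        (fun i => lam1 (Real.sqrt (A i) * r i) α + lam1 (Real.sqrt (A i) / r i) α) =
        2 * lam1 (Real.sqrt (∑ i, A i)) α ↔ n = 1 ∧ ∀ i, r i = 1) := by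
  have hR : ∀ a, 0 < a → IsFirstRobin a α (lam1 a α) := fun a ha => hlam a α ha hα
  have hs : ∀ i, 0 < √(A i) := fun i => sqrt_pos.2 (hA i)
  have hr0 : ∀ i, 0 < r i := fun i => one_pos.trans_le (hr i)
  have hrect_lt : ∀ i, r i ≠ 1 →
      2 * lam1 (√(A i)) α < lam1 (√(A i) * r i) α + lam1 (√(A i) / r i) α := fun i hi =>
    (hR _ (hs i)).two_mul_lt_add hα (hs i) ((hr i).lt_of_ne' hi)
      (hR _ (mul_pos (hs i) (hr0 i))) (hR _ (div_pos (hs i) (hr0 i)))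
  have hrect : ∀ i, 2 * lam1 (√(A i)) α ≤ lam1 (√(A i) * r i) α + lam1 (√(A i) / r i) α := by
    intro i
    by_cases hi : r i = 1
    · simp [hi, two_mul]
    · exact (hrect_lt i hi).le
  by_cases hn1 : n = 1
  · subst hn1
    have hinf : Finset.univ.inf' hne
        (fun i => lam1 (√(A i) * r i) α + lam1 (√(A i) / r i) α) =
        lam1 (√(A 0) * r 0) α + lam1 (√(A 0) / r 0) α := by
      simp [Finset.univ_unique]
    rw [hinf, Fin.sum_univ_one]
    refine ⟨hrect 0, fun h => ⟨rfl, fun i => ?_⟩, fun h => by simp [h.2, two_mul]⟩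
    by_contra hi
    rw [Subsingleton.elim i 0] at hi
    exact (hrect_lt 0 hi).ne' h
  · have hlt : 2 * lam1 (√(∑ i, A i)) α < Finset.univ.inf' hne
        (fun i => lam1 (√(A i) * r i) α + lam1 (√(A i) / r i) α) := by
      rw [Finset.lt_inf'_iff]
      intro i _
      have : Nontrivial (Fin n) := Fin.nontrivial_iff_two_le.2 (by omega)
      obtain ⟨j, hj⟩ := exists_ne i
      have hsum : A i < ∑ i, A i :=
        Finset.single_lt_sum hj (Finset.mem_univ i) (Finset.mem_univ j) (hA j)
          fun k _ _ => (hA k).le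
      have hsqrt := sqrt_lt_sqrt (hA i).le hsum
      have := (hR _ (hs i)).lt hα (hs i) (hR _ ((hs i).trans hsqrt)) hsqrt
      linarith [hrect i]
    exact ⟨hlt.le, fun h => absurd h hlt.ne', fun h => absurd h.1 hn1⟩
end

section
/- For every a > 0 and α > 0, the second Robin eigenvalue satisfies λ₂(a,α) ≤ (π/(2a) + √(π²/(4a²) + 2α/a))². -/
open Real

/-- For every `a > 0` and `α > 0`, the second Robin eigenvalue `λ₂(a,α)`, i.e. the unique
`λ ∈ (π²/a², 4π²/a²)` satisfying `α = −√λ · cot(a√λ/2)`, satisfies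
`λ₂(a,α) ≤ (π/(2a) + √(π²/(4a²) + 2α/a))²`. -/
theorem second_robin_eigenvalue_upper (a α lam : ℝ) (ha : 0 < a) (hα : 0 < α)
    (hmem : lam ∈ Set.Ioo (π ^ 2 / a ^ 2) (4 * π ^ 2 / a ^ 2))
    (heq : α = -(Real.sqrt lam * Real.cot (a * Real.sqrt lam / 2))) :
    lam ≤ (π / (2 * a) + Real.sqrt (π ^ 2 / (4 * a ^ 2) + 2 * α / a)) ^ 2 := by
  obtain ⟨hlow, hupp⟩ := hmem
  have hlam : 0 < lam := lt_trans (by positivity) hlow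
  set s := Real.sqrt lam with hs
  have hs_pos : 0 < s := Real.sqrt_pos.mpr hlam
  have hsq : s ^ 2 = lam := Real.sq_sqrt hlam.le
  have hpi := Real.pi_pos
  have hlow' : π < a * s := by
    rw [div_lt_iff₀ (by positivity), ← hsq] at hlow
    exact lt_of_pow_lt_pow_left₀ 2 (by positivity) (by linarith [mul_pow a s 2])
  have hupp' : a * s < 2 * π := by
    rw [lt_div_iff₀ (by positivity), ← hsq] at hupp
    exact lt_of_pow_lt_pow_left₀ 2 (by positivity) (by linarith [mul_pow a s 2, mul_pow 2 π 2])
  have htan : a * s / 2 - π / 2 ≤ Real.tan (a * s / 2 - π / 2) :=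
    Real.le_tan (by linarith) (by linarith)
  have hcot : Real.tan (a * s / 2 - π / 2) = -Real.cot (a * s / 2) := by
    rw [Real.tan_eq_sin_div_cos, Real.cot_eq_cos_div_sin, Real.sin_sub_pi_div_two,
      Real.cos_sub_pi_div_two, neg_div]
  have hα_eq : α = s * Real.tan (a * s / 2 - π / 2) := by rw [hcot, heq]; ring
  have hbound : s * (a * s - π) ≤ 2 * α := by
    rw [hα_eq]
    nlinarith [mul_le_mul_of_nonneg_left htan hs_pos.le]
  have hroot : s - π / (2 * a) ≤ Real.sqrt (π ^ 2 / (4 * a ^ 2) + 2 * α / a) := by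
    apply Real.le_sqrt_of_sq_le
    have hexpand : (s - π / (2 * a)) ^ 2 = π ^ 2 / (4 * a ^ 2) + s * (a * s - π) / a := by
      field_simp
      ring
    rw [hexpand]
    gcongr
  rw [← hsq]
  exact pow_le_pow_left₀ hs_pos.le (by linarith) 2
end

section
/- For every a > 0 and α > 0, the second Robin eigenvalue satisfies √(λ₂(a,α)) ≤ (π/(4a²α)) · (4aα − π² + √(π⁴ + 16a²α²)); equivalently λ₂(a,α) ≤ (π²/(16a⁴α²)) · (4aα − π² + √(π⁴ + 16a²α²))². -/
open Real

/-- If `u ∈ (0, π/2)` is written as `u = π w / 2` and `A = π (1 + w) tan u`, then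
`π² w ≤ 2 A (1 - w²)`. -/
lemma pi_sq_mul_le_of_eq_tan {A w : ℝ} (hw0 : 0 < w) (hw1 : w < 1)
    (hA : A = π * (1 + w) * tan (π * w / 2)) : π ^ 2 * w ≤ 2 * A * (1 - w ^ 2) := by
  have hpi := pi_pos
  have hw2 : 0 < 1 - w ^ 2 := by nlinarith
  rcases le_total (w + w ^ 2) 1 with h | h
  · have ht : π * w / 2 < tan (π * w / 2) := lt_tan (by positivity) (by nlinarith)
    have hA' : π * (1 + w) * (π * w / 2) ≤ A := by rw [hA]; gcongr
    have hc : 1 ≤ (1 + w) * (1 - w ^ 2) := by nlinarith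
    calc π ^ 2 * w ≤ π ^ 2 * w * ((1 + w) * (1 - w ^ 2)) :=
          le_mul_of_one_le_right (by positivity) hc
      _ = 2 * (π * (1 + w) * (π * w / 2)) * (1 - w ^ 2) := by ring
      _ ≤ 2 * A * (1 - w ^ 2) := by gcongr
  · have hw : 0.61 ≤ w := by nlinarith
    have hpi' : π < 3.15 := pi_lt_d2
    set u := π * (1 - w) / 2 with hu
    have hs0 : 0 < 1 - w := by linarith
    have hu0 : 0 < u := by positivity
    have hu1 : u ≤ 0.62 := by nlinarith
    have hcos : 0.8 ≤ cos u := by nlinarith [one_sub_sq_div_two_le_cos (x := u)]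
    have hsin : sin u ≤ u := sin_le hu0.le
    have hsin0 : 0 < sin u := sin_pos_of_pos_of_lt_pi hu0 (by linarith [pi_gt_three])
    have htan : tan (π * w / 2) = cos u / sin u := by
      rw [show π * w / 2 = π / 2 - u by rw [hu]; ring, tan_pi_div_two_sub, tan_eq_sin_div_cos,
        inv_div]
    have hlow : 0.8 / u ≤ tan (π * w / 2) := by rw [htan]; gcongr
    have hA' : π * (1 + w) * (0.8 / u) ≤ A := by rw [hA]; gcongr
    have hval : π * (1 + w) * (0.8 / u) * (1 - w) = 1.6 * (1 + w) := by
      rw [hu]; field_simp; norm_num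
    have hmul := mul_le_mul_of_nonneg_right hA' hs0.le
    rw [hval] at hmul
    have hpi2 : π ^ 2 ≤ 12.8 := by nlinarith
    calc π ^ 2 * w ≤ 12.8 * w := by gcongr
      _ ≤ 2 * (1.6 * (1 + w)) * (1 + w) := by nlinarith [sq_nonneg (1 - w)]
      _ ≤ 2 * (A * (1 - w)) * (1 + w) := by gcongr
      _ = 2 * A * (1 - w ^ 2) := by ring


/-- For every `a > 0` and `α > 0`, the second Robin eigenvalue `λ₂(a,α)`, i.e. the unique
`λ ∈ (π²/a², 4π²/a²)` satisfying `α = −√λ · cot(a√λ/2)`, satisfies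
`√(λ₂(a,α)) ≤ (π/(4a²α))·(4aα − π² + √(π⁴ + 16a²α²))`; equivalently
`λ₂(a,α) ≤ (π²/(16a⁴α²))·(4aα − π² + √(π⁴ + 16a²α²))²`. -/
theorem second_robin_eigenvalue_upper' (a α lam : ℝ) (ha : 0 < a) (hα : 0 < α)
    (hmem : lam ∈ Set.Ioo (π ^ 2 / a ^ 2) (4 * π ^ 2 / a ^ 2))
    (heq : α = -(Real.sqrt lam * Real.cot (a * Real.sqrt lam / 2))) :
    Real.sqrt lam ≤
      π / (4 * a ^ 2 * α) * (4 * a * α - π ^ 2 + Real.sqrt (π ^ 4 + 16 * a ^ 2 * α ^ 2)) ∧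
    lam ≤ π ^ 2 / (16 * a ^ 4 * α ^ 2) *
      (4 * a * α - π ^ 2 + Real.sqrt (π ^ 4 + 16 * a ^ 2 * α ^ 2)) ^ 2 := by
  obtain ⟨h1, h2⟩ := hmem
  have hpi := pi_pos
  have hlow : π / a < √lam := lt_sqrt_of_sq_lt (by rwa [div_pow])
  have hupp : √lam < 2 * π / a := by
    rw [sqrt_lt' (by positivity), div_pow, mul_pow]
    norm_num
    exact h2
  rw [div_lt_iff₀ ha] at hlow
  rw [lt_div_iff₀ ha] at hupp
  have hlam : 0 ≤ lam := (by positivity : 0 ≤ π ^ 2 / a ^ 2).trans h1.le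
  set x := √lam with hx
  obtain ⟨w, hw⟩ : ∃ w, x * a = π * (1 + w) := ⟨x * a / π - 1, by field_simp; ring⟩
  have hw0 : 0 < w := by nlinarith
  have hw1 : w < 1 := by nlinarith
  have hA : a * α = π * (1 + w) * tan (π * w / 2) := by
    have hcot : cot (a * x / 2) = -tan (π * w / 2) := by
      rw [show a * x / 2 = π * w / 2 + π / 2 by linarith, cot_eq_cos_div_sin, cos_add_pi_div_two,
        sin_add_pi_div_two, tan_eq_sin_div_cos, neg_div]
    rw [hcot] at heq
    rw [heq, ← hw]
    ring
  have hkey := pi_sq_mul_le_of_eq_tan hw0 hw1 hA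
  have hroot : 4 * (a * α) * w + π ^ 2 ≤ √(π ^ 4 + 16 * a ^ 2 * α ^ 2) := by
    apply le_sqrt_of_sq_le
    have := mul_le_mul_of_nonneg_left hkey (by positivity : 0 ≤ 8 * (a * α))
    linarith
  have hmain : x ≤ π / (4 * a ^ 2 * α) *
      (4 * a * α - π ^ 2 + √(π ^ 4 + 16 * a ^ 2 * α ^ 2)) := by
    calc x = π * (1 + w) / a := by rw [← hw]; field_simp
      _ = π / (4 * a ^ 2 * α) * (4 * a * α - π ^ 2 + (4 * (a * α) * w + π ^ 2)) := by
        field_simp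
        ring
      _ ≤ _ := by gcongr
  refine ⟨hmain, ?_⟩
  calc lam = x ^ 2 := (sq_sqrt hlam).symm
    _ ≤ _ := pow_le_pow_left₀ (sqrt_nonneg _) hmain 2
    _ = _ := by
      rw [mul_pow, div_pow]
      ring
end

section
/- For every a > 0 and α > 0, the second Robin eigenvalue satisfies λ₂(a,α) ≥ (2π − aα + √(4π² + 12aαπ + a²α²))² / (16a²). -/
open Real

/-- On `[π/2, π)`, the cotangent satisfies `-cot x * (π - x) ≤ 2 * x - π`. -/
theorem neg_cot_mul_pi_sub_le {x : ℝ} (h₁ : π / 2 ≤ x) (h₂ : x < π) :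
    -Real.cot x * (π - x) ≤ 2 * x - π := by
  have hsin : 0 < Real.sin x := Real.sin_pos_of_pos_of_lt_pi (by linarith [Real.pi_pos]) h₂
  have hsin_ge : (π - x) / 2 ≤ Real.sin x := by
    have h := Real.mul_le_sin (x := π - x) (by linarith) (by linarith)
    rw [Real.sin_pi_sub] at h
    have hpi : (1 : ℝ) / 2 ≤ 2 / π := by
      rw [div_le_div_iff₀ two_pos Real.pi_pos]
      linarith [Real.pi_le_four]
    nlinarith
  have hcos : -Real.cos x ≤ x - π / 2 := by
    rw [← Real.sin_sub_pi_div_two]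
    exact Real.sin_le (by linarith)
  rw [Real.cot_eq_cos_div_sin, ← neg_div, div_mul_eq_mul_div, div_le_iff₀ hsin]
  nlinarith [mul_le_mul_of_nonneg_right hcos (sub_nonneg.2 h₂.le),
    mul_le_mul_of_nonneg_left hsin_ge (by linarith : 0 ≤ 2 * x - π)]

/-- For every `a > 0` and `α > 0`, the second Robin eigenvalue `λ₂(a,α)`, i.e. the unique
`λ ∈ (π²/a², 4π²/a²)` satisfying `α = −√λ · cot(a√λ/2)`, satisfies
`λ₂(a,α) ≥ (2π − aα + √(4π² + 12aαπ + a²α²))²/(16a²)`. -/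
theorem second_robin_eigenvalue_lower (a α lam : ℝ) (ha : 0 < a) (hα : 0 < α)
    (hmem : lam ∈ Set.Ioo (π ^ 2 / a ^ 2) (4 * π ^ 2 / a ^ 2))
    (heq : α = -(Real.sqrt lam * Real.cot (a * Real.sqrt lam / 2))) :
    (2 * π - a * α + Real.sqrt (4 * π ^ 2 + 12 * a * α * π + a ^ 2 * α ^ 2)) ^ 2 /
        (16 * a ^ 2) ≤ lam := by
  obtain ⟨hlo, hhi⟩ := hmem
  have hlam : 0 < lam := lt_trans (by positivity) hlo
  have hsq : √lam ^ 2 = lam := Real.sq_sqrt hlam.le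
  set s := √lam with hs
  have hspos : 0 < s := Real.sqrt_pos.2 hlam
  have hlo' : π < a * s := by
    refine lt_of_pow_lt_pow_left₀ 2 (by positivity) ?_
    rw [div_lt_iff₀ (by positivity)] at hlo
    rw [mul_pow, hsq]
    linarith
  have hhi' : a * s < 2 * π := by
    refine lt_of_pow_lt_pow_left₀ 2 (by positivity) ?_
    rw [lt_div_iff₀ (by positivity)] at hhi
    rw [mul_pow, hsq]
    linarith
  have key := neg_cot_mul_pi_sub_le (x := a * s / 2) (by linarith) (by linarith)
  have hA : 0 < a * α := mul_pos ha hα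
  have hquad : a * α * (π - a * s / 2) ≤ a * s * (a * s - π) := by
    calc a * α * (π - a * s / 2)
        = a * s * (-Real.cot (a * s / 2) * (π - a * s / 2)) := by rw [heq]; ring
      _ ≤ a * s * (2 * (a * s / 2) - π) := by gcongr
      _ = a * s * (a * s - π) := by ring
  have hsqrt : √(4 * π ^ 2 + 12 * a * α * π + a ^ 2 * α ^ 2) ≤ 4 * (a * s) - 2 * π + a * α := by
    rw [Real.sqrt_le_left (by linarith)]
    nlinarith
  have hnonneg : 0 ≤ 2 * π - a * α + √(4 * π ^ 2 + 12 * a * α * π + a ^ 2 * α ^ 2) := by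
    have : a * α ≤ √(4 * π ^ 2 + 12 * a * α * π + a ^ 2 * α ^ 2) := by
      refine Real.le_sqrt_of_sq_le ?_
      nlinarith [mul_pos hA Real.pi_pos, sq_nonneg π]
    linarith [Real.pi_pos]
  rw [div_le_iff₀ (by positivity)]
  calc _ ≤ (4 * (a * s)) ^ 2 := by
        gcongr
        linarith
    _ = lam * (16 * a ^ 2) := by rw [← hsq]; ring
end

section
/- There exist real numbers c₁ ∈ (0, π/2), c₂ ∈ (0, π/(2√3)) and c₃ ∈ (π/(2√3), π/√3) such that c₁·tan(c₁) = c₂·tan(√3·c₂), c₁·tan(c₁) = −c₃·cot(√3·c₃), and 2c₁² = c₂² + c₃². Moreover, any such solution satisfies π/(2√6) < c₁ < √5·π/(2√6) and 4/5 < 2c₁·tan(c₁) < 5π²/2. -/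
open Real

/-- For `c ≥ 0`, the map `x ↦ (x + c) * tan x` from `(0, π/2)` onto `(0, ∞)` has a continuous
right inverse. -/
theorem exists_continuousOn_inverse_add_mul_tan {c : ℝ} (hc : 0 ≤ c) :
    ∃ φ : ℝ → ℝ, ContinuousOn φ (Set.Ioi 0) ∧
      ∀ y, 0 < y → φ y ∈ Set.Ioo 0 (π / 2) ∧ (φ y + c) * tan (φ y) = y := by
  set g : ℝ → ℝ := fun x => (x + c) * tan x
  have tan_mono : ∀ x y, 0 < x → x < y → y < π / 2 → tan x < tan y := fun x y hx hxy hy =>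
    tan_lt_tan_of_lt_of_lt_pi_div_two (by linarith) hy hxy
  have g_mono : StrictMonoOn g (Set.Ioo 0 (π / 2)) := by
    intro x hx y hy hxy
    have h := tan_mono x y hx.1 hxy hy.2
    have h₀ := tan_pos_of_pos_of_lt_pi_div_two hx.1 hx.2
    exact mul_lt_mul'' (by linarith) h (by linarith [hx.1]) h₀.le
  have g_surj : ∀ y, 0 < y → ∃ x ∈ Set.Ioo 0 (π / 2), g x = y := by
    intro y hy
    have htend : Filter.Tendsto g (nhdsWithin (π / 2) (Set.Iio (π / 2))) Filter.atTop := by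
      refine Filter.Tendsto.pos_mul_atTop (C := π / 2 + c) (by linarith [pi_pos]) ?_
        tendsto_tan_pi_div_two
      exact ((continuous_id.add continuous_const).tendsto (π / 2)).mono_left nhdsWithin_le_nhds
    have hpos : ∀ᶠ x in nhdsWithin (π / 2) (Set.Iio (π / 2)), x ∈ Set.Ioo 0 (π / 2) :=
      Ioo_mem_nhdsLT (by linarith [pi_pos])
    obtain ⟨b, hb, hyb⟩ := (hpos.and (htend.eventually_ge_atTop y)).exists
    have hcont : ContinuousOn g (Set.Icc 0 b) := by
      refine (continuousOn_id.add continuousOn_const).mul (continuousOn_tan_Ioo.mono ?_)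
      intro x hx
      exact ⟨by linarith [hx.1, pi_pos], by linarith [hx.2, hb.2]⟩
    have hg0 : g 0 = 0 := by simp [g]
    obtain ⟨x, hx, rfl⟩ := intermediate_value_Icc hb.1.le hcont ⟨hg0.trans_le hy.le, hyb⟩
    refine ⟨x, ⟨hx.1.lt_of_ne ?_, hx.2.trans_lt hb.2⟩, rfl⟩
    rintro rfl
    exact hy.ne' hg0
  have g_image : g '' Set.Ioo 0 (π / 2) = Set.Ioi 0 := by
    ext y
    constructor
    · rintro ⟨x, hx, rfl⟩
      exact mul_pos (by linarith [hx.1]) (tan_pos_of_pos_of_lt_pi_div_two hx.1 hx.2)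
    · exact g_surj y
  let e : Set.Ioo 0 (π / 2) ≃o Set.Ioi (0 : ℝ) :=
    (g_mono.orderIso g _).trans (OrderIso.setCongr _ _ g_image)
  have he : ∀ x, ((e x : Set.Ioi (0 : ℝ)) : ℝ) = g x := fun _ => rfl
  refine ⟨fun y => if hy : 0 < y then (e.symm ⟨y, hy⟩ : ℝ) else 0, ?_, ?_⟩
  · rw [continuousOn_iff_continuous_domRestrict]
    convert continuous_subtype_val.comp e.symm.continuous using 1
    ext y
    simp [show (0 : ℝ) < y from y.2]
  · intro y hy
    simp only [hy, dif_pos]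
    refine ⟨(e.symm ⟨y, hy⟩).2, ?_⟩
    have := he (e.symm ⟨y, hy⟩)
    rw [e.apply_symm_apply] at this
    exact this.symm

theorem mul_tan_lt_of_sq_le {x : ℝ} (hx : x ∈ Set.Ioo 0 (π / 2)) (h : x ^ 2 ≤ 5 * π ^ 2 / 24) :
    x * tan x < 5 * π ^ 2 / 4 := by
  have hx' : x < 23 / 50 * π := by
    refine lt_of_pow_lt_pow_left₀ 2 (by linarith [pi_pos]) ?_
    nlinarith [sq_pos_of_pos pi_pos]
  have hd : 0 < π / 2 - x := by linarith [hx.2]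
  have htan : tan x < (π / 2 - x)⁻¹ := by
    have h₁ := lt_tan hd (by linarith [hx.1])
    rw [tan_pi_div_two_sub] at h₁
    have := (inv_lt_inv₀ (hd.trans h₁) hd).2 h₁
    rwa [inv_inv] at this
  calc x * tan x < x * (π / 2 - x)⁻¹ := mul_lt_mul_of_pos_left htan hx.1
    _ ≤ 5 * π ^ 2 / 4 := by
      rw [← div_eq_mul_inv, div_le_iff₀ hd]
      have h9 : 9.8 < π ^ 2 := by nlinarith [pi_gt_d2]
      nlinarith [mul_le_mul h9.le (show 1 / 25 * π ≤ π / 2 - x by linarith)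
        (by linarith [pi_pos]) (by positivity)]

theorem sq_lt_mul_tan {x : ℝ} (hx : x ∈ Set.Ioo 0 (π / 2)) : x ^ 2 < x * tan x := by
  rw [sq]
  exact mul_lt_mul_of_pos_left (lt_tan hx.1 hx.2) hx.1

theorem neg_cot_add_pi_div_two (x : ℝ) : -cot (x + π / 2) = tan x := by
  rw [cot_eq_cos_div_sin, cos_add_pi_div_two, sin_add_pi_div_two, tan_eq_sin_div_cos]
  ring

theorem exists_transition_system_solution :
    ∃ c₁ c₂ c₃ : ℝ, c₁ ∈ Set.Ioo 0 (π / 2) ∧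
      c₂ ∈ Set.Ioo 0 (π / (2 * √3)) ∧ c₃ ∈ Set.Ioo (π / (2 * √3)) (π / √3) ∧
      c₁ * tan c₁ = c₂ * tan (√3 * c₂) ∧ c₁ * tan c₁ = -(c₃ * cot (√3 * c₃)) ∧
      2 * c₁ ^ 2 = c₂ ^ 2 + c₃ ^ 2 := by
  obtain ⟨φ, hφc, hφ⟩ := exists_continuousOn_inverse_add_mul_tan le_rfl
  obtain ⟨ψ, hψc, hψ⟩ := exists_continuousOn_inverse_add_mul_tan (c := π / 2) (by positivity)
  have h3 : (0 : ℝ) < √3 := by positivity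
  have h3s : √3 ^ 2 = 3 := sq_sqrt (by norm_num)
  have hmaps : Set.MapsTo (fun y => √3 * y) (Set.Ioi 0) (Set.Ioi 0) := fun y hy => mul_pos h3 hy
  have hlin : ContinuousOn (fun y => √3 * y) (Set.Ioi 0) := by fun_prop
  let F : ℝ → ℝ := fun y => 6 * φ y ^ 2 - φ (√3 * y) ^ 2 - (ψ (√3 * y) + π / 2) ^ 2
  have hF : ContinuousOn F (Set.Ioi 0) :=
    ((continuousOn_const.mul (hφc.pow 2)).sub ((hφc.comp hlin hmaps).pow 2)).sub
      (((hψc.comp hlin hmaps).add continuousOn_const).pow 2)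
  have hlow : F (1 / 6) ≤ 0 := by
    obtain ⟨hs, hs'⟩ := hφ (1 / 6) (by norm_num)
    obtain ⟨hu, -⟩ := hψ (√3 * (1 / 6)) (by positivity)
    have := sq_lt_mul_tan hs
    rw [add_zero] at hs'
    simp only [F]
    nlinarith [hu.1, pi_gt_three, sq_nonneg (φ (√3 * (1 / 6)))]
  have hhigh : 0 ≤ F (5 * π ^ 2 / 4) := by
    obtain ⟨hs, hs'⟩ := hφ (5 * π ^ 2 / 4) (by positivity)
    obtain ⟨ht, -⟩ := hφ (√3 * (5 * π ^ 2 / 4)) (by positivity)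
    obtain ⟨hu, -⟩ := hψ (√3 * (5 * π ^ 2 / 4)) (by positivity)
    rw [add_zero] at hs'
    have hsq : 5 * π ^ 2 / 24 < φ (5 * π ^ 2 / 4) ^ 2 := by
      by_contra! h
      exact (mul_tan_lt_of_sq_le hs h).ne hs'
    have h₁ := pow_lt_pow_left₀ ht.2 ht.1.le two_ne_zero
    have h₂ := pow_lt_pow_left₀ (show ψ (√3 * (5 * π ^ 2 / 4)) + π / 2 < π by linarith [hu.2])
      (by linarith [hu.1, pi_pos]) two_ne_zero
    simp only [F]
    linarith
  have hle : (1 / 6 : ℝ) ≤ 5 * π ^ 2 / 4 := by nlinarith [pi_gt_three]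
  obtain ⟨y, hy, hFy⟩ := intermediate_value_Icc hle
    (hF.mono fun y hy => lt_of_lt_of_le (by norm_num) hy.1) ⟨hlow, hhigh⟩
  have hy0 : 0 < y := lt_of_lt_of_le (by norm_num) hy.1
  obtain ⟨hs, hs'⟩ := hφ y hy0
  obtain ⟨ht, ht'⟩ := hφ (√3 * y) (by positivity)
  obtain ⟨hu, hu'⟩ := hψ (√3 * y) (by positivity)
  simp only [F] at hFy
  rw [add_zero] at hs' ht'
  have hcancel : ∀ x, √3 * (x / √3) = x := fun x => mul_div_cancel₀ x h3.ne'
  have hhalf : π / (2 * √3) = π / 2 / √3 := by rw [div_div]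
  refine ⟨φ y, φ (√3 * y) / √3, (ψ (√3 * y) + π / 2) / √3, hs, ⟨div_pos ht.1 h3, ?_⟩,
    ⟨?_, ?_⟩, ?_, ?_, ?_⟩
  · rw [hhalf]
    exact div_lt_div_of_pos_right ht.2 h3
  · rw [hhalf]
    exact div_lt_div_of_pos_right (by linarith [hu.1]) h3
  · exact div_lt_div_of_pos_right (by linarith [hu.2]) h3
  · rw [hcancel, hs', div_mul_eq_mul_div, ht', mul_div_cancel_left₀ _ h3.ne']
  · rw [hcancel, hs', ← mul_neg, neg_cot_add_pi_div_two, div_mul_eq_mul_div, hu',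
      mul_div_cancel_left₀ _ h3.ne']
  · rw [div_pow, div_pow, h3s]
    linarith

/-- There exist `c₁ ∈ (0, π/2)`, `c₂ ∈ (0, π/(2√3))` and `c₃ ∈ (π/(2√3), π/√3)` such that
`c₁·tan c₁ = c₂·tan(√3·c₂)`, `c₁·tan c₁ = −c₃·cot(√3·c₃)` and `2c₁² = c₂² + c₃²`.
Moreover, any such solution satisfies `π/(2√6) < c₁ < √5·π/(2√6)` and
`4/5 < 2c₁·tan c₁ < 5π²/2`. -/
theorem transition_system_solution :
    (∃ c₁ c₂ c₃ : ℝ, c₁ ∈ Set.Ioo 0 (π / 2) ∧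
      c₂ ∈ Set.Ioo 0 (π / (2 * Real.sqrt 3)) ∧
      c₃ ∈ Set.Ioo (π / (2 * Real.sqrt 3)) (π / Real.sqrt 3) ∧
      c₁ * Real.tan c₁ = c₂ * Real.tan (Real.sqrt 3 * c₂) ∧
      c₁ * Real.tan c₁ = -(c₃ * Real.cot (Real.sqrt 3 * c₃)) ∧
      2 * c₁ ^ 2 = c₂ ^ 2 + c₃ ^ 2) ∧
    ∀ c₁ c₂ c₃ : ℝ, c₁ ∈ Set.Ioo 0 (π / 2) →
      c₂ ∈ Set.Ioo 0 (π / (2 * Real.sqrt 3)) →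
      c₃ ∈ Set.Ioo (π / (2 * Real.sqrt 3)) (π / Real.sqrt 3) →
      c₁ * Real.tan c₁ = c₂ * Real.tan (Real.sqrt 3 * c₂) →
      c₁ * Real.tan c₁ = -(c₃ * Real.cot (Real.sqrt 3 * c₃)) →
      2 * c₁ ^ 2 = c₂ ^ 2 + c₃ ^ 2 →
      π / (2 * Real.sqrt 6) < c₁ ∧ c₁ < Real.sqrt 5 * π / (2 * Real.sqrt 6) ∧
        4 / 5 < 2 * c₁ * Real.tan c₁ ∧ 2 * c₁ * Real.tan c₁ < 5 * π ^ 2 / 2 := by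
  refine ⟨exists_transition_system_solution, ?_⟩
  intro c₁ c₂ c₃ h₁ h₂ h₃ _ _ hsum
  have h3 : √3 ^ 2 = 3 := sq_sqrt (by norm_num)
  have h5 : √5 ^ 2 = 5 := sq_sqrt (by norm_num)
  have h6 : √6 ^ 2 = 6 := sq_sqrt (by norm_num)
  have hc₂ := pow_lt_pow_left₀ h₂.2 h₂.1.le two_ne_zero
  have hc₃ := pow_lt_pow_left₀ h₃.1 (by positivity) two_ne_zero
  have hc₃' := pow_lt_pow_left₀ h₃.2 (le_trans (by positivity) h₃.1.le) two_ne_zero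
  rw [div_pow, mul_pow, h3] at hc₂ hc₃
  rw [div_pow, h3] at hc₃'
  have hlow : π ^ 2 / 24 < c₁ ^ 2 := by linarith [sq_pos_of_pos h₂.1]
  have hhigh : c₁ ^ 2 < 5 * π ^ 2 / 24 := by linarith
  refine ⟨?_, ?_, ?_, ?_⟩
  · refine lt_of_pow_lt_pow_left₀ 2 h₁.1.le ?_
    rw [div_pow, mul_pow, h6]
    linarith
  · refine lt_of_pow_lt_pow_left₀ 2 (by positivity) ?_
    rw [div_pow, mul_pow, mul_pow, h5, h6]
    linarith
  · have := sq_lt_mul_tan h₁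
    nlinarith [pi_gt_d2]
  · linarith [mul_tan_lt_of_sq_le h₁ hhigh.le]
end

section
/- Fix α > 0. Then a·λ₁(a,α) → 2α as a → 0⁺, and more precisely λ₁(a,α) − 2α/a → −α²/3 as a → 0⁺. -/
open Real

/-- The slope of the tangent at the origin tends to `1` from the right. -/
lemma tendsto_tan_div_self_nhdsGT :
    Filter.Tendsto (fun t : ℝ => tan t / t) (nhdsWithin 0 (Set.Ioi 0)) (nhds 1) := by
  have h : HasDerivAt tan 1 0 := by simpa using Real.hasDerivAt_tan (x := 0) (by simp)
  have h' := h.tendsto_slope.mono_left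
    (nhdsWithin_mono 0 (fun x hx => ne_of_gt hx : Set.Ioi (0 : ℝ) ⊆ {0}ᶜ))
  refine h'.congr fun t => ?_
  simp [slope_def_field]

/-- The leading coefficient of `tan t - t` at the origin. -/
lemma tendsto_tan_sub_self_div_cube_nhdsGT :
    Filter.Tendsto (fun t : ℝ => (tan t - t) / t ^ 3) (nhdsWithin 0 (Set.Ioi 0))
      (nhds (1 / 3)) := by
  have hev : ∀ᶠ t : ℝ in nhdsWithin 0 (Set.Ioi 0), 0 < t ∧ t < π / 2 :=
    Ioo_mem_nhdsGT (by positivity)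
  have hcont : ContinuousAt tan (0 : ℝ) := Real.continuousAt_tan.2 (by simp)
  refine HasDerivAt.lhopital_zero_nhdsGT (f' := fun t => tan t ^ 2) (g' := fun t => 3 * t ^ 2)
    ?_ ?_ ?_ ?_ ?_ ?_
  · filter_upwards [hev] with t ht
    have hc : cos t ≠ 0 := (cos_pos_of_mem_Ioo ⟨by linarith, ht.2⟩).ne'
    refine ((Real.hasDerivAt_tan hc).sub (hasDerivAt_id t)).congr_deriv ?_
    rw [Real.tan_eq_sin_div_cos]
    field_simp
    linarith [sin_sq_add_cos_sq t]
  · exact .of_forall fun t => by simpa using hasDerivAt_pow 3 t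
  · filter_upwards [hev] with t ht
    have := ht.1
    positivity
  · have h : ContinuousAt (fun t : ℝ => tan t - t) 0 := hcont.sub continuousAt_id
    simpa using h.tendsto.mono_left nhdsWithin_le_nhds
  · have h : ContinuousAt (fun t : ℝ => t ^ 3) 0 := by fun_prop
    simpa using h.tendsto.mono_left nhdsWithin_le_nhds
  · have h := (tendsto_tan_div_self_nhdsGT.pow 2).div_const 3
    simp only [one_pow] at h
    refine h.congr fun t => ?_
    ring

lemma tendsto_self_sub_tan_div_nhdsGT :
    Filter.Tendsto (fun t : ℝ => (t - tan t) / (t * tan t ^ 2)) (nhdsWithin 0 (Set.Ioi 0))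
      (nhds (-1 / 3)) := by
  have h := (tendsto_tan_sub_self_div_cube_nhdsGT.neg).div
    (tendsto_tan_div_self_nhdsGT.pow 2) (by norm_num)
  have e : -(1 / 3) / (1 : ℝ) ^ 2 = -1 / 3 := by norm_num
  rw [e] at h
  refine h.congr' ?_
  filter_upwards [Ioo_mem_nhdsGT (show (0 : ℝ) < π / 2 by positivity)] with t ht
  have ht0 : t ≠ 0 := ht.1.ne'
  have htan : tan t ≠ 0 := (tan_pos_of_pos_of_lt_pi_div_two ht.1 ht.2).ne'
  simp only [Pi.div_apply]
  field_simp
  ring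

/-- Fix `α > 0`, and let `lam1 a = λ₁(a,α)` denote the first Robin eigenvalue of an interval
of length `a`, i.e. the unique `λ ∈ (0, π²/a²)` with `α = √λ · tan(a√λ/2)`. Then
`a·λ₁(a,α) → 2α` as `a → 0⁺`, and more precisely `λ₁(a,α) − 2α/a → −α²/3` as `a → 0⁺`. -/
theorem first_robin_eigenvalue_small_a_asymptotics (α : ℝ) (hα : 0 < α) (lam1 : ℝ → ℝ)
    (hlam : ∀ a : ℝ, 0 < a → lam1 a ∈ Set.Ioo 0 (π ^ 2 / a ^ 2) ∧
      α = Real.sqrt (lam1 a) * Real.tan (a * Real.sqrt (lam1 a) / 2)) :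
    Filter.Tendsto (fun a => a * lam1 a) (nhdsWithin 0 (Set.Ioi 0)) (nhds (2 * α)) ∧
    Filter.Tendsto (fun a => lam1 a - 2 * α / a) (nhdsWithin 0 (Set.Ioi 0))
      (nhds (-(α ^ 2) / 3)) := by
  set t : ℝ → ℝ := fun a => a * √(lam1 a) / 2 with ht_def
  have key : ∀ a : ℝ, 0 < a → 0 < t a ∧ t a < π / 2 ∧ a * α / 2 = t a * tan (t a) ∧
      lam1 a = 4 * t a ^ 2 / a ^ 2 := by
    intro a ha
    obtain ⟨⟨h0, h1⟩, h2⟩ := hlam a ha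
    have hs : 0 < √(lam1 a) := Real.sqrt_pos.2 h0
    have hsq : √(lam1 a) ^ 2 = lam1 a := Real.sq_sqrt h0.le
    refine ⟨by positivity, ?_, ?_, ?_⟩
    · have : √(lam1 a) < π / a := by
        rw [Real.sqrt_lt' (by positivity), div_pow]
        exact h1
      rw [lt_div_iff₀ ha] at this
      simp only [ht_def]
      linarith
    · simp only [ht_def]
      linear_combination (a / 2) * h2
    · simp only [ht_def]
      field_simp
      linarith
  have ht_pos : ∀ᶠ a in nhdsWithin (0 : ℝ) (Set.Ioi 0), t a ∈ Set.Ioi (0 : ℝ) := by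
    filter_upwards [self_mem_nhdsWithin] with a ha using (key a ha).1
  have hid : Filter.Tendsto (fun a : ℝ => a) (nhdsWithin 0 (Set.Ioi 0)) (nhds 0) :=
    nhdsWithin_le_nhds
  have hsqrt : Filter.Tendsto (fun a : ℝ => √(a * α / 2)) (nhdsWithin 0 (Set.Ioi 0))
      (nhds 0) := by
    simpa using ((hid.mul_const α).div_const 2).sqrt
  have ht_zero : Filter.Tendsto t (nhdsWithin 0 (Set.Ioi 0)) (nhds 0) := by
    refine tendsto_of_tendsto_of_tendsto_of_le_of_le' tendsto_const_nhds hsqrt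
      (ht_pos.mono fun a ha => le_of_lt ha) ?_
    filter_upwards [self_mem_nhdsWithin] with a ha
    obtain ⟨h0, h1, h2, -⟩ := key a ha
    refine Real.le_sqrt_of_sq_le ?_
    rw [h2]
    nlinarith [Real.lt_tan h0 h1]
  have ht : Filter.Tendsto t (nhdsWithin 0 (Set.Ioi 0)) (nhdsWithin 0 (Set.Ioi 0)) :=
    tendsto_nhdsWithin_iff.2 ⟨ht_zero, ht_pos⟩
  have second : Filter.Tendsto (fun a => lam1 a - 2 * α / a) (nhdsWithin 0 (Set.Ioi 0))
      (nhds (-(α ^ 2) / 3)) := by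
    have h := (tendsto_self_sub_tan_div_nhdsGT.comp ht).const_mul (α ^ 2)
    have e : α ^ 2 * (-1 / 3) = -(α ^ 2) / 3 := by ring
    rw [e] at h
    refine h.congr' ?_
    filter_upwards [self_mem_nhdsWithin] with a ha
    obtain ⟨h0, h1, h2, h3⟩ := key a ha
    have htan : 0 < tan (t a) := tan_pos_of_pos_of_lt_pi_div_two h0 h1
    have ha' : a = 2 * (t a * tan (t a)) / α := by
      rw [← h2]
      field_simp
    simp only [Function.comp_apply]
    rw [h3]
    generalize t a = s at *
    subst ha'
    field_simp
    ring
  refine ⟨?_, second⟩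
  have h := (hid.mul second).add_const (2 * α)
  simp only [zero_mul, zero_add] at h
  refine h.congr' ?_
  filter_upwards [self_mem_nhdsWithin] with a ha
  have ha0 : a ≠ 0 := ne_of_gt ha
  field_simp
  ring
end
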